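/- arXiv:2107.11051 — 2 statements merged into one kernel-verified Lean document; each statement's English description precedes it below -/
import Mathlib

section
/- Consider the abstract mixed dG(w) framework with data f ∈ L¹(I;X) and u₀ ∈ X. (i) If (u,p) ∈ X_τ^w(X) × X_τ^w(M) solves the full velocity–pressure scheme, then u(t) ∈ V for all t ∈ I and u solves the reduced scheme on X_τ^w(V). (ii) If u ∈ X_τ^w(V) solves the reduced scheme, then there exists a unique p ∈ X_τ^w(M) such that the pair (u,p) solves the full velocity–pressure scheme. In particular, the full velocity–pressure scheme has a unique solution whenever the reduced scheme does. -/
open MeasureTheory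
open scoped RealInnerProductSpace

/-- `U m` is, for each `m = 1, …, M`, a `Y`-valued polynomial of degree at most `w`
(the `m`-th piece of a function in `X_τ^w(Y)`). -/
def PPoly {Y : Type} [AddCommGroup Y] [Module ℝ Y] (w M : ℕ) (U : ℕ → ℝ → Y) : Prop :=
  ∀ m, 1 ≤ m → m ≤ M → ∃ c : Fin (w + 1) → Y, ∀ s : ℝ, U m s = ∑ j : Fin (w + 1), s ^ (j : ℕ) • c j

/-- The full velocity–pressure dG(w) scheme: for all piecewise polynomial test functions
`(Φ, Q)`, `∑_m ∫_{I_m} (⟪∂_t u, v⟫ + a(u,v) - b(v,p) + b(u,q)) + ∑_{m=2}^M ⟪[u]_{m-1}, v_{m-1}^+⟫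
+ ⟪u_0^+, v_0^+⟫ = ∫_I ⟪f, v⟫ + ⟪u₀, v_0^+⟫`. -/
def FullScheme {X Mp : Type}
    [NormedAddCommGroup X] [InnerProductSpace ℝ X]
    [NormedAddCommGroup Mp] [InnerProductSpace ℝ Mp]
    (a : X →ₗ[ℝ] X →ₗ[ℝ] ℝ) (b : X →ₗ[ℝ] Mp →ₗ[ℝ] ℝ)
    (w M : ℕ) (t : ℕ → ℝ) (f : ℝ → X) (u₀ : X)
    (U : ℕ → ℝ → X) (P : ℕ → ℝ → Mp) : Prop :=
  ∀ (Φ : ℕ → ℝ → X) (Q : ℕ → ℝ → Mp), PPoly w M Φ → PPoly w M Q →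
    (∑ m ∈ Finset.Icc 1 M, ∫ σ in t (m - 1)..t m,
        (⟪deriv (U m) σ, Φ m σ⟫ + a (U m σ) (Φ m σ)
          - b (Φ m σ) (P m σ) + b (U m σ) (Q m σ)))
      + (∑ m ∈ Finset.Icc 2 M, ⟪U m (t (m - 1)) - U (m - 1) (t (m - 1)), Φ m (t (m - 1))⟫)
      + ⟪U 1 (t 0), Φ 1 (t 0)⟫
    = (∑ m ∈ Finset.Icc 1 M, ∫ σ in t (m - 1)..t m, ⟪f σ, Φ m σ⟫)
      + ⟪u₀, Φ 1 (t 0)⟫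

/-- The reduced dG(w) scheme on the discretely divergence-free space
`V = {v : b(v,·) = 0}`: the same identity with the pressure terms omitted, tested with
piecewise polynomial functions with values in `V`. -/
def ReducedScheme {X Mp : Type}
    [NormedAddCommGroup X] [InnerProductSpace ℝ X]
    [NormedAddCommGroup Mp] [InnerProductSpace ℝ Mp]
    (a : X →ₗ[ℝ] X →ₗ[ℝ] ℝ) (b : X →ₗ[ℝ] Mp →ₗ[ℝ] ℝ)
    (w M : ℕ) (t : ℕ → ℝ) (f : ℝ → X) (u₀ : X)
    (U : ℕ → ℝ → X) : Prop :=
  ∀ Φ : ℕ → ℝ → X, PPoly w M Φ →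
    (∀ m, 1 ≤ m → m ≤ M → ∀ σ : ℝ, ∀ q : Mp, b (Φ m σ) q = 0) →
    (∑ m ∈ Finset.Icc 1 M, ∫ σ in t (m - 1)..t m,
        (⟪deriv (U m) σ, Φ m σ⟫ + a (U m σ) (Φ m σ)))
      + (∑ m ∈ Finset.Icc 2 M, ⟪U m (t (m - 1)) - U (m - 1) (t (m - 1)), Φ m (t (m - 1))⟫)
      + ⟪U 1 (t 0), Φ 1 (t 0)⟫
    = (∑ m ∈ Finset.Icc 1 M, ∫ σ in t (m - 1)..t m, ⟪f σ, Φ m σ⟫)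
      + ⟪u₀, Φ 1 (t 0)⟫

/-- The polynomial function with coefficients `c`. -/
def polyFun {Y : Type} [AddCommGroup Y] [Module ℝ Y] {w : ℕ} (c : Fin (w + 1) → Y) (s : ℝ) : Y :=
  ∑ j : Fin (w + 1), s ^ (j : ℕ) • c j

section Polynomials

variable {Y Z : Type} [NormedAddCommGroup Y] [InnerProductSpace ℝ Y]
  [NormedAddCommGroup Z] [InnerProductSpace ℝ Z] {w M : ℕ}

theorem polyFun_add (c d : Fin (w + 1) → Y) (s : ℝ) :
    polyFun (c + d) s = polyFun c s + polyFun d s := by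
  simp [polyFun, smul_add, Finset.sum_add_distrib]

theorem polyFun_smul (r : ℝ) (c : Fin (w + 1) → Y) (s : ℝ) :
    polyFun (r • c) s = r • polyFun c s := by
  simp only [polyFun, Pi.smul_apply, Finset.smul_sum]
  exact Finset.sum_congr rfl fun j _ => smul_comm _ _ _

theorem map_polyFun (S : Y →ₗ[ℝ] Z) (c : Fin (w + 1) → Y) (s : ℝ) :
    S (polyFun c s) = polyFun (fun j => S (c j)) s := by
  simp [polyFun]

theorem contDiff_polyFun (c : Fin (w + 1) → Y) : ContDiff ℝ 1 (polyFun c) := by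
  unfold polyFun
  fun_prop

theorem continuous_polyFun (c : Fin (w + 1) → Y) : Continuous (polyFun c) :=
  (contDiff_polyFun c).continuous

/-- A polynomial vanishing on a nontrivial interval has vanishing coefficients. -/
theorem eq_zero_of_polyFun_eq_zero {α β : ℝ} (hαβ : α < β) (c : Fin (w + 1) → Y)
    (h : ∀ s ∈ Set.Icc α β, polyFun c s = 0) : c = 0 := by
  funext j
  refine ext_inner_right ℝ fun y => ?_
  let q : Polynomial ℝ := ∑ i : Fin (w + 1), Polynomial.monomial (i : ℕ) ⟪c i, y⟫
  have hq : q = 0 := by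
    refine Polynomial.eq_zero_of_infinite_isRoot q ((Set.Icc_infinite hαβ).mono fun s hs => ?_)
    have hs' : ⟪polyFun c s, y⟫ = 0 := by rw [h s hs, inner_zero_left]
    simp only [polyFun, sum_inner, real_inner_smul_left] at hs'
    simp only [Set.mem_ofPred_eq, Polynomial.IsRoot, q, Polynomial.eval_finsetSum,
      Polynomial.eval_monomial]
    rw [← hs']
    exact Finset.sum_congr rfl fun i _ => mul_comm _ _
  have hc : q.coeff (j : ℕ) = ⟪c j, y⟫ := by
    simp only [q, Polynomial.finsetSum_coeff, Polynomial.coeff_monomial]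
    simp [Fin.val_inj]
  simpa [hq] using hc.symm

theorem eq_zero_of_integral_inner_self_nonpos {α β : ℝ} (hαβ : α < β) {g : ℝ → Y}
    (hg : Continuous g) (h : ∫ σ in α..β, ⟪g σ, g σ⟫ ≤ 0) {σ : ℝ} (hσ : σ ∈ Set.Icc α β) :
    g σ = 0 := by
  by_contra hne
  have hpos : 0 < ∫ σ in α..β, ⟪g σ, g σ⟫ :=
    intervalIntegral.integral_pos hαβ (hg.inner hg).continuousOn
      (fun x _ => real_inner_self_nonneg) ⟨σ, hσ, real_inner_self_pos.2 hne⟩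
  exact absurd h (not_le.2 hpos)

/-- Riesz representation on the space of polynomials of degree at most `w` with the `L²` inner
product over a nontrivial interval. -/
theorem exists_polyFun_representative [FiniteDimensional ℝ Y] {α β : ℝ} (hαβ : α < β)
    (l : (Fin (w + 1) → Y) →ₗ[ℝ] ℝ) :
    ∃ d : Fin (w + 1) → Y, ∀ c, ∫ σ in α..β, ⟪polyFun c σ, polyFun d σ⟫ = l c := by
  have hint : ∀ c d : Fin (w + 1) → Y,
      IntervalIntegrable (fun σ => ⟪polyFun c σ, polyFun d σ⟫) volume α β := fun c d =>
    ((continuous_polyFun c).inner (continuous_polyFun d)).intervalIntegrable α β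
  let G : (Fin (w + 1) → Y) →ₗ[ℝ] Module.Dual ℝ (Fin (w + 1) → Y) :=
    LinearMap.mk₂ ℝ (fun d c => ∫ σ in α..β, ⟪polyFun c σ, polyFun d σ⟫)
      (fun d d' c => by
        simp only [polyFun_add, inner_add_right]
        exact intervalIntegral.integral_add (hint _ _) (hint _ _))
      (fun r d c => by
        simp only [polyFun_smul, real_inner_smul_right, smul_eq_mul]
        exact intervalIntegral.integral_const_mul _ _)
      (fun d c c' => by
        simp only [polyFun_add, inner_add_left]
        exact intervalIntegral.integral_add (hint _ _) (hint _ _))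
      (fun r d c => by
        simp only [polyFun_smul, real_inner_smul_left, smul_eq_mul]
        exact intervalIntegral.integral_const_mul _ _)
  have hinj : Function.Injective G := by
    refine (injective_iff_map_eq_zero G).2 fun d hd => ?_
    have h0 : ∫ σ in α..β, ⟪polyFun d σ, polyFun d σ⟫ = 0 := LinearMap.congr_fun hd d
    exact eq_zero_of_polyFun_eq_zero hαβ d fun s hs =>
      eq_zero_of_integral_inner_self_nonpos hαβ (continuous_polyFun d) h0.le hs
  have hsurj : Function.Surjective G :=
    (LinearMap.injective_iff_surjective_of_finrank_eq_finrank
      (Subspace.dual_finrank_eq).symm).1 hinj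
  obtain ⟨d, hd⟩ := hsurj l
  exact ⟨d, fun c => LinearMap.congr_fun hd c⟩

theorem pPoly_iff {U : ℕ → ℝ → Y} :
    PPoly w M U ↔ ∀ m, 1 ≤ m → m ≤ M → ∃ c : Fin (w + 1) → Y, U m = polyFun c := by
  simp only [PPoly, funext_iff, polyFun]

theorem PPoly.contDiff {U : ℕ → ℝ → Y} (hU : PPoly w M U) {m : ℕ} (h1 : 1 ≤ m) (hM : m ≤ M) :
    ContDiff ℝ 1 (U m) := by
  obtain ⟨c, hc⟩ := pPoly_iff.1 hU m h1 hM
  exact hc ▸ contDiff_polyFun c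

theorem PPoly.continuous {U : ℕ → ℝ → Y} (hU : PPoly w M U) {m : ℕ} (h1 : 1 ≤ m) (hM : m ≤ M) :
    Continuous (U m) :=
  (hU.contDiff h1 hM).continuous

theorem PPoly.zero : PPoly w M (fun (_ : ℕ) (_ : ℝ) => (0 : Y)) := fun _ _ _ =>
  ⟨0, fun s => by simp⟩

theorem PPoly.map (S : Y →ₗ[ℝ] Z) {U : ℕ → ℝ → Y} (hU : PPoly w M U) :
    PPoly w M (fun m s => S (U m s)) := fun m h1 hM => by
  obtain ⟨c, hc⟩ := hU m h1 hM
  exact ⟨fun j => S (c j), fun s => by simp [hc s]⟩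

theorem PPoly.sub {U W : ℕ → ℝ → Y} (hU : PPoly w M U) (hW : PPoly w M W) :
    PPoly w M (fun m s => U m s - W m s) := fun m h1 hM => by
  obtain ⟨c, hc⟩ := hU m h1 hM
  obtain ⟨d, hd⟩ := hW m h1 hM
  exact ⟨c - d, fun s => by simp [hc s, hd s, smul_sub, Finset.sum_sub_distrib]⟩

theorem eq_zero_of_sum_integral_inner_self_eq_zero {t : ℕ → ℝ}
    (ht : ∀ m, 1 ≤ m → m ≤ M → t (m - 1) < t m) {D : ℕ → ℝ → Y} (hD : PPoly w M D)
    (h : ∑ m ∈ Finset.Icc 1 M, ∫ σ in t (m - 1)..t m, ⟪D m σ, D m σ⟫ = 0)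
    {m : ℕ} (h1 : 1 ≤ m) (hM : m ≤ M) {σ : ℝ} (hσ : σ ∈ Set.Ioc (t (m - 1)) (t m)) :
    D m σ = 0 := by
  have hnonneg : ∀ k ∈ Finset.Icc 1 M, 0 ≤ ∫ σ in t (k - 1)..t k, ⟪D k σ, D k σ⟫ := fun k hk =>
    intervalIntegral.integral_nonneg
      (ht k (Finset.mem_Icc.1 hk).1 (Finset.mem_Icc.1 hk).2).le fun _ _ => real_inner_self_nonneg
  exact eq_zero_of_integral_inner_self_nonpos (ht m h1 hM) (hD.continuous h1 hM)
    ((Finset.sum_eq_zero_iff_of_nonneg hnonneg).1 h m (Finset.mem_Icc.2 ⟨h1, hM⟩)).le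
    (Set.Ioc_subset_Icc_self hσ)

end Polynomials

/-- Every bilinear form with finite-dimensional second factor is represented by a linear map. -/
theorem exists_linearMap_inner_eq {X Y : Type} [AddCommGroup X] [Module ℝ X]
    [NormedAddCommGroup Y] [InnerProductSpace ℝ Y] [FiniteDimensional ℝ Y]
    (b : X →ₗ[ℝ] Y →ₗ[ℝ] ℝ) : ∃ R : X →ₗ[ℝ] Y, ∀ x y, b x y = ⟪R x, y⟫ := by
  have : CompleteSpace Y := FiniteDimensional.complete ℝ Y
  refine ⟨IsLinearMap.mk' (fun x => (InnerProductSpace.toDual ℝ Y).symm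
    (LinearMap.toContinuousLinearMap (b x))) ⟨fun x y => by simp, fun r x => by simp⟩,
    fun x y => ?_⟩
  simp [InnerProductSpace.toDual_symm_apply]

/-- The inf-sup condition makes the operator `R` representing `b` surjective. -/
theorem surjective_of_infsup {X Y : Type} [NormedAddCommGroup X] [InnerProductSpace ℝ X]
    [NormedAddCommGroup Y] [InnerProductSpace ℝ Y] [FiniteDimensional ℝ Y]
    (a : X →ₗ[ℝ] X →ₗ[ℝ] ℝ) (b : X →ₗ[ℝ] Y →ₗ[ℝ] ℝ) {β₀ : ℝ} (hβ₀ : 0 < β₀)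
    (hinfsup : ∀ q : Y,
      β₀ * ‖q‖ ≤ ⨆ v : {v : X // v ≠ 0}, b (v : X) q / Real.sqrt (a (v : X) (v : X)))
    (R : X →ₗ[ℝ] Y) (hR : ∀ x y, b x y = ⟪R x, y⟫) : Function.Surjective R := by
  have : CompleteSpace Y := FiniteDimensional.complete ℝ Y
  rw [← LinearMap.range_eq_top, ← Submodule.orthogonal_eq_bot_iff, Submodule.eq_bot_iff]
  intro q hq
  have hb : ∀ v, b v q = 0 := fun v => by
    rw [hR]
    exact (Submodule.mem_orthogonal _ q).1 hq _ (LinearMap.mem_range_self R v)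
  have h := hinfsup q
  simp only [hb, zero_div, Real.iSup_const_zero] at h
  exact norm_le_zero_iff.1 (nonpos_of_mul_nonpos_right h hβ₀)

section Residual

variable {X Mp : Type} [NormedAddCommGroup X] [InnerProductSpace ℝ X] [FiniteDimensional ℝ X]
  [NormedAddCommGroup Mp] [InnerProductSpace ℝ Mp] [FiniteDimensional ℝ Mp]
  {w M : ℕ} {t : ℕ → ℝ} {f : ℝ → X} {u₀ : X} {U : ℕ → ℝ → X} {A : X →ₗ[ℝ] X}

/-- The jump of `U` at `t (m - 1)`, relative to the initial value `u₀` for `m = 1`. -/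
noncomputable def jump (t : ℕ → ℝ) (u₀ : X) (U : ℕ → ℝ → X) (m : ℕ) : X :=
  if m = 1 then U 1 (t 0) - u₀ else U m (t (m - 1)) - U (m - 1) (t (m - 1))

/-- The momentum residual on the `m`-th interval, without pressure term. -/
noncomputable def momentumResidual (A : X →ₗ[ℝ] X) (t : ℕ → ℝ) (f : ℝ → X) (u₀ : X) (U : ℕ → ℝ → X)
    (m : ℕ) (φ : ℝ → X) : ℝ :=
  (∫ σ in t (m - 1)..t m, ⟪deriv (U m) σ + A (U m σ) - f σ, φ σ⟫)
    + ⟪jump t u₀ U m, φ (t (m - 1))⟫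

theorem intervalIntegrable_inner {α β : ℝ} {g φ : ℝ → X} (hg : IntervalIntegrable g volume α β)
    (hφ : Continuous φ) : IntervalIntegrable (fun σ => ⟪g σ, φ σ⟫) volume α β := by
  obtain ⟨C, hC⟩ := (isCompact_uIcc (a := α) (b := β)).exists_bound_of_continuousOn hφ.continuousOn
  rw [intervalIntegrable_iff] at hg ⊢
  refine (hg.norm.mul_const C).mono' (hg.aestronglyMeasurable.inner hφ.aestronglyMeasurable) ?_
  refine (ae_restrict_iff' measurableSet_uIoc).2 (Filter.Eventually.of_forall fun σ hσ => ?_)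
  exact (norm_inner_le_norm _ _).trans
    (mul_le_mul_of_nonneg_left (hC σ (Set.uIoc_subset_uIcc hσ)) (norm_nonneg _))

theorem continuous_velocity (A : X →ₗ[ℝ] X) (hU : PPoly w M U) {m : ℕ} (h1 : 1 ≤ m) (hM : m ≤ M) :
    Continuous fun σ => deriv (U m) σ + A (U m σ) :=
  ((hU.contDiff h1 hM).continuous_deriv le_rfl).add
    (A.continuous_of_finiteDimensional.comp (hU.continuous h1 hM))

theorem momentumResidual_add {m : ℕ} (hU : PPoly w M U) (h1 : 1 ≤ m) (hM : m ≤ M)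
    (hf : IntervalIntegrable f volume (t (m - 1)) (t m)) {φ ψ : ℝ → X}
    (hφ : Continuous φ) (hψ : Continuous ψ) :
    momentumResidual A t f u₀ U m (fun σ => φ σ + ψ σ)
      = momentumResidual A t f u₀ U m φ + momentumResidual A t f u₀ U m ψ := by
  have hg := ((continuous_velocity A hU h1 hM).intervalIntegrable (t (m - 1)) (t m)).sub hf
  simp only [momentumResidual, inner_add_right]
  rw [intervalIntegral.integral_add (intervalIntegrable_inner hg hφ)
    (intervalIntegrable_inner hg hψ)]
  ring

theorem momentumResidual_smul (m : ℕ) (r : ℝ) (φ : ℝ → X) :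
    momentumResidual A t f u₀ U m (fun σ => r • φ σ) = r * momentumResidual A t f u₀ U m φ := by
  simp only [momentumResidual, real_inner_smul_right, intervalIntegral.integral_const_mul]
  ring

theorem sum_momentumResidual (hM : 1 ≤ M) (hU : PPoly w M U)
    (hf : ∀ m, 1 ≤ m → m ≤ M → IntervalIntegrable f volume (t (m - 1)) (t m))
    {Φ : ℕ → ℝ → X} (hΦ : PPoly w M Φ) :
    ∑ m ∈ Finset.Icc 1 M, momentumResidual A t f u₀ U m (Φ m)
      = (∑ m ∈ Finset.Icc 1 M, ∫ σ in t (m - 1)..t m, ⟪deriv (U m) σ + A (U m σ), Φ m σ⟫)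
        + (∑ m ∈ Finset.Icc 2 M, ⟪U m (t (m - 1)) - U (m - 1) (t (m - 1)), Φ m (t (m - 1))⟫)
        + ⟪U 1 (t 0), Φ 1 (t 0)⟫
        - ((∑ m ∈ Finset.Icc 1 M, ∫ σ in t (m - 1)..t m, ⟪f σ, Φ m σ⟫) + ⟪u₀, Φ 1 (t 0)⟫) := by
  have hint : ∀ m ∈ Finset.Icc 1 M,
      ∫ σ in t (m - 1)..t m, ⟪deriv (U m) σ + A (U m σ) - f σ, Φ m σ⟫
        = (∫ σ in t (m - 1)..t m, ⟪deriv (U m) σ + A (U m σ), Φ m σ⟫)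
          - ∫ σ in t (m - 1)..t m, ⟪f σ, Φ m σ⟫ := fun m hm => by
    obtain ⟨h1, h2⟩ := Finset.mem_Icc.1 hm
    have hc := hΦ.continuous h1 h2
    rw [← intervalIntegral.integral_sub
      (intervalIntegrable_inner ((continuous_velocity A hU h1 h2).intervalIntegrable _ _) hc)
      (intervalIntegrable_inner (hf m h1 h2) hc)]
    simp only [inner_sub_left]
  have hjump : ∑ m ∈ Finset.Icc 1 M, ⟪jump t u₀ U m, Φ m (t (m - 1))⟫
      = (∑ m ∈ Finset.Icc 2 M, ⟪U m (t (m - 1)) - U (m - 1) (t (m - 1)), Φ m (t (m - 1))⟫)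
        + (⟪U 1 (t 0), Φ 1 (t 0)⟫ - ⟪u₀, Φ 1 (t 0)⟫) := by
    have hsplit : Finset.Icc 1 M = insert 1 (Finset.Icc 2 M) := by
      ext k
      simp only [Finset.mem_Icc, Finset.mem_insert]
      omega
    rw [hsplit, Finset.sum_insert (by simp), add_comm]
    congr 1
    · refine Finset.sum_congr rfl fun m hm => ?_
      have : m ≠ 1 := by
        have := (Finset.mem_Icc.1 hm).1
        omega
      simp [jump, this]
    · simp [jump, inner_sub_left]
  simp only [momentumResidual, Finset.sum_add_distrib]
  rw [Finset.sum_congr rfl hint, hjump, Finset.sum_sub_distrib]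
  ring

variable {a : X →ₗ[ℝ] X →ₗ[ℝ] ℝ} {b : X →ₗ[ℝ] Mp →ₗ[ℝ] ℝ} {R : X →ₗ[ℝ] Mp}

theorem reducedScheme_iff (hA : ∀ x y, a x y = ⟪A x, y⟫) (hR : ∀ x y, b x y = ⟪R x, y⟫)
    (hM : 1 ≤ M) (hU : PPoly w M U)
    (hf : ∀ m, 1 ≤ m → m ≤ M → IntervalIntegrable f volume (t (m - 1)) (t m)) :
    ReducedScheme a b w M t f u₀ U ↔ ∀ Φ : ℕ → ℝ → X, PPoly w M Φ →
      (∀ m, 1 ≤ m → m ≤ M → ∀ σ : ℝ, R (Φ m σ) = 0) →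
      ∑ m ∈ Finset.Icc 1 M, momentumResidual A t f u₀ U m (Φ m) = 0 := by
  have hV : ∀ x, (∀ q, b x q = 0) ↔ R x = 0 := fun x => by
    simp only [hR]
    exact ⟨fun h => inner_self_eq_zero.1 (h (R x)), fun h q => by rw [h, inner_zero_left]⟩
  unfold ReducedScheme
  simp only [hV, hA]
  refine forall_congr' fun Φ => forall_congr' fun hΦ => forall_congr' fun _ => ?_
  rw [sum_momentumResidual hM hU hf hΦ, sub_eq_zero]
  simp only [inner_add_left]

theorem fullScheme_iff (hA : ∀ x y, a x y = ⟪A x, y⟫) (hR : ∀ x y, b x y = ⟪R x, y⟫)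
    (hM : 1 ≤ M) (hU : PPoly w M U)
    (hf : ∀ m, 1 ≤ m → m ≤ M → IntervalIntegrable f volume (t (m - 1)) (t m))
    {P : ℕ → ℝ → Mp} (hP : PPoly w M P) :
    FullScheme a b w M t f u₀ U P ↔
      ∀ (Φ : ℕ → ℝ → X) (Q : ℕ → ℝ → Mp), PPoly w M Φ → PPoly w M Q →
      (∑ m ∈ Finset.Icc 1 M, momentumResidual A t f u₀ U m (Φ m))
        - (∑ m ∈ Finset.Icc 1 M, ∫ σ in t (m - 1)..t m, ⟪R (Φ m σ), P m σ⟫)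
        + (∑ m ∈ Finset.Icc 1 M, ∫ σ in t (m - 1)..t m, ⟪R (U m σ), Q m σ⟫) = 0 := by
  unfold FullScheme
  refine forall_congr' fun Φ => forall_congr' fun Q => forall_congr' fun hΦ =>
    forall_congr' fun hQ => ?_
  have hint : ∀ m ∈ Finset.Icc 1 M,
      ∫ σ in t (m - 1)..t m, (⟪deriv (U m) σ, Φ m σ⟫ + a (U m σ) (Φ m σ)
          - b (Φ m σ) (P m σ) + b (U m σ) (Q m σ))
        = (∫ σ in t (m - 1)..t m, ⟪deriv (U m) σ + A (U m σ), Φ m σ⟫)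
          - (∫ σ in t (m - 1)..t m, ⟪R (Φ m σ), P m σ⟫)
          + ∫ σ in t (m - 1)..t m, ⟪R (U m σ), Q m σ⟫ := fun m hm => by
    obtain ⟨h1, h2⟩ := Finset.mem_Icc.1 hm
    have hv := intervalIntegrable_inner ((continuous_velocity A hU h1 h2).intervalIntegrable
      (μ := volume) (t (m - 1)) (t m)) (hΦ.continuous h1 h2)
    have hp := intervalIntegrable_inner (((hΦ.map R).continuous h1 h2).intervalIntegrable
      (μ := volume) (t (m - 1)) (t m)) (hP.continuous h1 h2)
    have hq := intervalIntegrable_inner (((hU.map R).continuous h1 h2).intervalIntegrable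
      (μ := volume) (t (m - 1)) (t m)) (hQ.continuous h1 h2)
    rw [← intervalIntegral.integral_sub hv hp, ← intervalIntegral.integral_add (hv.sub hp) hq]
    simp only [hA, hR, inner_add_left]
  rw [sum_momentumResidual hM hU hf hΦ, Finset.sum_congr rfl hint, Finset.sum_add_distrib,
    Finset.sum_sub_distrib]
  constructor <;> intro h <;> linarith

/-- The momentum residual composed with a linear lifting `S` is represented by a polynomial
pressure. -/
theorem exists_pPoly_representative (S : Mp →ₗ[ℝ] X) (hU : PPoly w M U)
    (ht : ∀ m, 1 ≤ m → m ≤ M → t (m - 1) < t m)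
    (hf : ∀ m, 1 ≤ m → m ≤ M → IntervalIntegrable f volume (t (m - 1)) (t m)) :
    ∃ P : ℕ → ℝ → Mp, PPoly w M P ∧ ∀ Q : ℕ → ℝ → Mp, PPoly w M Q → ∀ m, 1 ≤ m → m ≤ M →
      ∫ σ in t (m - 1)..t m, ⟪Q m σ, P m σ⟫ = momentumResidual A t f u₀ U m (fun σ => S (Q m σ)) := by
  have key : ∀ m, ∃ d : Fin (w + 1) → Mp, 1 ≤ m → m ≤ M → ∀ c : Fin (w + 1) → Mp,
      ∫ σ in t (m - 1)..t m, ⟪polyFun c σ, polyFun d σ⟫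
        = momentumResidual A t f u₀ U m (fun σ => S (polyFun c σ)) := fun m => by
    by_cases hm : 1 ≤ m ∧ m ≤ M
    · have hS : ∀ c : Fin (w + 1) → Mp, Continuous fun σ => S (polyFun c σ) := fun c =>
        S.continuous_of_finiteDimensional.comp (continuous_polyFun c)
      let l : (Fin (w + 1) → Mp) →ₗ[ℝ] ℝ :=
        { toFun := fun c => momentumResidual A t f u₀ U m (fun σ => S (polyFun c σ))
          map_add' := fun c d => by
            simp only [polyFun_add, map_add]
            exact momentumResidual_add hU hm.1 hm.2 (hf m hm.1 hm.2) (hS c) (hS d)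
          map_smul' := fun r c => by
            simp only [polyFun_smul, map_smul]
            exact momentumResidual_smul m r _ }
      obtain ⟨d, hd⟩ := exists_polyFun_representative (ht m hm.1 hm.2) l
      exact ⟨d, fun _ _ => hd⟩
    · exact ⟨0, fun h1 h2 => absurd ⟨h1, h2⟩ hm⟩
  choose d hd using key
  refine ⟨fun m => polyFun (d m), pPoly_iff.2 fun m _ _ => ⟨d m, rfl⟩, fun Q hQ m h1 h2 => ?_⟩
  obtain ⟨c, hc⟩ := pPoly_iff.1 hQ m h1 h2
  rw [hc]
  exact hd m h1 h2 c

end Residual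

/-- **Equivalence of the velocity–pressure and the discretely divergence-free dG(w)
formulations (Proposition 4.1), abstract form.**  (i) If `(u, p)` solves the full scheme then
`u(t) ∈ V` for all `t ∈ I` and `u` solves the reduced scheme.  (ii) If `u ∈ X_τ^w(V)` solves
the reduced scheme, there is a unique `p ∈ X_τ^w(M)` such that `(u, p)` solves the full
scheme. -/
theorem stmt5 (X Mp : Type)
    [NormedAddCommGroup X] [InnerProductSpace ℝ X] [FiniteDimensional ℝ X]
    [NormedAddCommGroup Mp] [InnerProductSpace ℝ Mp] [FiniteDimensional ℝ Mp]
    (a : X →ₗ[ℝ] X →ₗ[ℝ] ℝ) (b : X →ₗ[ℝ] Mp →ₗ[ℝ] ℝ)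
    (hasymm : ∀ u v : X, a u v = a v u)
    (hapos : ∀ v : X, v ≠ 0 → 0 < a v v)
    (β₀ : ℝ) (hβ₀ : 0 < β₀)
    (hinfsup : ∀ q : Mp,
      β₀ * ‖q‖ ≤ ⨆ v : {v : X // v ≠ 0}, b (v : X) q / Real.sqrt (a (v : X) (v : X)))
    (T : ℝ) (hT : 0 < T) (M : ℕ) (hM : 1 ≤ M) (w : ℕ)
    (t : ℕ → ℝ) (ht0 : t 0 = 0) (htM : t M = T)
    (hmono : ∀ m, m < M → t m < t (m + 1))
    (f : ℝ → X) (hf : IntegrableOn f (Set.Ioc 0 T)) (u₀ : X) :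
    (∀ (U : ℕ → ℝ → X) (P : ℕ → ℝ → Mp), PPoly w M U → PPoly w M P →
      FullScheme a b w M t f u₀ U P →
        (∀ m, 1 ≤ m → m ≤ M → ∀ σ ∈ Set.Ioc (t (m - 1)) (t m), ∀ q : Mp, b (U m σ) q = 0) ∧
          ReducedScheme a b w M t f u₀ U) ∧
    (∀ U : ℕ → ℝ → X, PPoly w M U →
      (∀ m, 1 ≤ m → m ≤ M → ∀ σ : ℝ, ∀ q : Mp, b (U m σ) q = 0) →
      ReducedScheme a b w M t f u₀ U →
        ∃ P : ℕ → ℝ → Mp, PPoly w M P ∧ FullScheme a b w M t f u₀ U P ∧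
          ∀ P' : ℕ → ℝ → Mp, PPoly w M P' → FullScheme a b w M t f u₀ U P' →
            ∀ m, 1 ≤ m → m ≤ M → ∀ σ ∈ Set.Ioc (t (m - 1)) (t m), P' m σ = P m σ) := by
  obtain ⟨A, hA⟩ := exists_linearMap_inner_eq a
  obtain ⟨R, hR⟩ := exists_linearMap_inner_eq b
  obtain ⟨S, hS⟩ := R.exists_rightInverse_of_surjective
    (LinearMap.range_eq_top.2 (surjective_of_infsup a b hβ₀ hinfsup R hR))
  have hRS : ∀ q, R (S q) = q := fun q => LinearMap.congr_fun hS q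
  have ht : ∀ m, 1 ≤ m → m ≤ M → t (m - 1) < t m := fun m h1 h2 => by
    have := hmono (m - 1) (by omega)
    rwa [Nat.sub_add_cancel h1] at this
  have hle : ∀ j, j ≤ M → ∀ i, i ≤ j → t i ≤ t j := fun j hj i hij => by
    induction j, hij using Nat.le_induction with
    | base => exact le_rfl
    | succ k _ ih => exact (ih (by omega)).trans (hmono k (by omega)).le
  have hfi : ∀ m, 1 ≤ m → m ≤ M → IntervalIntegrable f volume (t (m - 1)) (t m) :=
    fun m h1 h2 => by
      rw [intervalIntegrable_iff_integrableOn_Ioc_of_le (ht m h1 h2).le]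
      refine hf.mono_set (Set.Ioc_subset_Ioc ?_ ?_)
      · exact ht0 ▸ hle (m - 1) (by omega) 0 (Nat.zero_le _)
      · exact htM ▸ hle M le_rfl m h2
  refine ⟨fun U P hU hP hfull => ?_, fun U hU hUV hred => ?_⟩
  · rw [fullScheme_iff hA hR hM hU hfi hP] at hfull
    refine ⟨fun m h1 h2 σ hσ q => ?_, (reducedScheme_iff hA hR hM hU hfi).2 fun Φ hΦ hΦV => ?_⟩
    · have h := hfull _ _ PPoly.zero (hU.map R)
      simp only [momentumResidual, map_zero, inner_zero_left, inner_zero_right,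
        intervalIntegral.integral_zero, Finset.sum_const_zero, add_zero, sub_zero, zero_add] at h
      rw [hR, eq_zero_of_sum_integral_inner_self_eq_zero ht (hU.map R) h h1 h2 hσ,
        inner_zero_left]
    · have h := hfull Φ _ hΦ PPoly.zero
      have hp : ∑ m ∈ Finset.Icc 1 M, ∫ σ in t (m - 1)..t m, ⟪R (Φ m σ), P m σ⟫ = 0 :=
        Finset.sum_eq_zero fun m hm => by
          simp [hΦV m (Finset.mem_Icc.1 hm).1 (Finset.mem_Icc.1 hm).2]
      simpa [hp] using h
  · rw [reducedScheme_iff hA hR hM hU hfi] at hred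
    obtain ⟨P, hP, hrep⟩ := exists_pPoly_representative (A := A) (u₀ := u₀) S hU ht hfi
    have hfull : FullScheme a b w M t f u₀ U P := by
      rw [fullScheme_iff hA hR hM hU hfi hP]
      intro Φ Q hΦ hQ
      have hq : ∑ m ∈ Finset.Icc 1 M, ∫ σ in t (m - 1)..t m, ⟪R (U m σ), Q m σ⟫ = 0 :=
        Finset.sum_eq_zero fun m hm => by
          simp [← hR, hUV m (Finset.mem_Icc.1 hm).1 (Finset.mem_Icc.1 hm).2]
      have hΨ := (hΦ.map R).map S
      have hker := hred _ (hΦ.sub hΨ) fun m _ _ σ => by rw [map_sub, hRS, sub_self]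
      rw [hq, add_zero, ← hker, ← Finset.sum_sub_distrib]
      refine Finset.sum_congr rfl fun m hm => ?_
      obtain ⟨h1, h2⟩ := Finset.mem_Icc.1 hm
      rw [hrep _ (hΦ.map R) m h1 h2, sub_eq_iff_eq_add,
        ← momentumResidual_add hU h1 h2 (hfi m h1 h2) ((hΦ.sub hΨ).continuous h1 h2)
          (hΨ.continuous h1 h2)]
      simp only [sub_add_cancel]
    refine ⟨P, hP, hfull, fun P' hP' hfull' m h1 h2 σ hσ => ?_⟩
    have hD := hP'.sub hP
    rw [fullScheme_iff hA hR hM hU hfi hP] at hfull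
    rw [fullScheme_iff hA hR hM hU hfi hP'] at hfull'
    have e := hfull _ _ (hD.map S) PPoly.zero
    have e' := hfull' _ _ (hD.map S) PPoly.zero
    simp only [hRS] at e e'
    refine sub_eq_zero.1 (eq_zero_of_sum_integral_inner_self_eq_zero ht hD ?_ h1 h2 hσ)
    have hsub : ∀ k ∈ Finset.Icc 1 M,
        ∫ σ in t (k - 1)..t k, ⟪P' k σ - P k σ, P' k σ - P k σ⟫
          = (∫ σ in t (k - 1)..t k, ⟪P' k σ - P k σ, P' k σ⟫)
            - ∫ σ in t (k - 1)..t k, ⟪P' k σ - P k σ, P k σ⟫ := fun k hk => by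
      obtain ⟨k1, k2⟩ := Finset.mem_Icc.1 hk
      have hc := hD.continuous k1 k2
      rw [← intervalIntegral.integral_sub
        ((hc.inner (hP'.continuous k1 k2)).intervalIntegrable _ _)
        ((hc.inner (hP.continuous k1 k2)).intervalIntegrable _ _)]
      refine intervalIntegral.integral_congr fun σ _ => ?_
      exact inner_sub_right _ _ _
    rw [Finset.sum_congr rfl hsub, Finset.sum_sub_distrib]
    linarith
end

section
/- Smoothing estimate for the discrete pressure gradient (abstract form of Corollary 8.3): there exists a constant C, depending only on the polynomial degree w, the mesh constants κ, c, β, the gradient inf-sup constant C_G and the constant c_Δ, such that the following holds. In the abstract mixed dG(w) framework with ambient space H, let f = 0 and u₀ ∈ H, and let (u_τ, p_τ) ∈ X_τ^w(X) × X_τ^w(M) solve the full velocity–pressure scheme. Then for every m = 1,…,M, sup_{t∈I_m} ‖G p_τ(t)‖_H ≤ (C/t_m)·‖u₀‖_H. -/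
open MeasureTheory
open scoped RealInnerProductSpace ENNReal

/-- The full velocity–pressure dG(w) scheme in the ambient space `H`, with
`b(v, q) = -⟪v, G q⟫_H` (so `-b(v,p) = ⟪v, G p⟫_H`):
`∑_m ∫_{I_m} (⟪∂_t u, v⟫_H + a(u,v) - b(v,p) + b(u,q)) + ∑_{m=2}^M ⟪[u]_{m-1}, v_{m-1}^+⟫_H
+ ⟪u_0^+, v_0^+⟫_H = ∫_I ⟪f, v⟫_H + ⟪u₀, v_0^+⟫_H` for all piecewise polynomial `(v, q)`. -/
def FullSchemeH {H Mp : Type}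
    [NormedAddCommGroup H] [InnerProductSpace ℝ H]
    [NormedAddCommGroup Mp] [InnerProductSpace ℝ Mp]
    {X : Submodule ℝ H}
    (a : X →ₗ[ℝ] X →ₗ[ℝ] ℝ) (G : Mp →ₗ[ℝ] H)
    (w M : ℕ) (t : ℕ → ℝ) (f : ℝ → H) (u₀ : H)
    (U : ℕ → ℝ → X) (P : ℕ → ℝ → Mp) : Prop :=
  ∀ (Φ : ℕ → ℝ → X) (Q : ℕ → ℝ → Mp), PPoly w M Φ → PPoly w M Q →
    (∑ m ∈ Finset.Icc 1 M, ∫ σ in t (m - 1)..t m,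
        (⟪((deriv (U m) σ : X) : H), ((Φ m σ : X) : H)⟫ + a (U m σ) (Φ m σ)
          + ⟪(Φ m σ : H), G (P m σ)⟫ - ⟪(U m σ : H), G (Q m σ)⟫))
      + (∑ m ∈ Finset.Icc 2 M,
          ⟪((U m (t (m - 1)) - U (m - 1) (t (m - 1)) : X) : H), (Φ m (t (m - 1)) : H)⟫)
      + ⟪((U 1 (t 0) : X) : H), (Φ 1 (t 0) : H)⟫
    = (∑ m ∈ Finset.Icc 1 M, ∫ σ in t (m - 1)..t m, ⟪f σ, (Φ m σ : H)⟫)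
      + ⟪u₀, (Φ 1 (t 0) : H)⟫

open Polynomial in
/-- The coefficients of a polynomial of degree at most `w` are bounded by its `L²(0,1)` norm. -/
theorem exists_sq_coeff_le_integral_sq (w : ℕ) :
    ∃ δ : ℝ, 0 < δ ∧ ∀ p : ℝ[X], p.natDegree ≤ w → ∀ j,
      δ * p.coeff j ^ 2 ≤ ∫ x in (0 : ℝ)..1, p.eval x ^ 2 := by
  let N : (Fin (w + 1) → ℝ) → ℝ := fun c =>
    ∫ x in (0 : ℝ)..1, (∑ j : Fin (w + 1), c j * x ^ (j : ℕ)) ^ 2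
  have hN : Continuous N := by
    apply intervalIntegral.continuous_parametric_intervalIntegral_of_continuous'
    fun_prop
  have hsmul : ∀ (r : ℝ) c, N (r • c) = r ^ 2 * N c := by
    intro r c
    simp only [N, Pi.smul_apply, smul_eq_mul, ← intervalIntegral.integral_const_mul]
    refine intervalIntegral.integral_congr fun x _ => ?_
    simp only [mul_assoc, ← Finset.mul_sum, mul_pow]
  have hpos : ∀ c, c ≠ 0 → 0 < N c := by
    intro c hc
    let p : ℝ[X] := ∑ j : Fin (w + 1), C (c j) * X ^ (j : ℕ)
    have hp : p ≠ 0 := by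
      intro h
      apply hc
      ext i
      have := congrArg (fun q : ℝ[X] => q.coeff i) h
      simpa [p, finsetSum_coeff, coeff_C_mul, coeff_X_pow, Fin.val_inj] using this
    have hcont : ContinuousOn (fun x => p.eval x ^ 2) (Set.Icc 0 1) := by fun_prop
    have h : 0 < ∫ x in (0 : ℝ)..1, p.eval x ^ 2 := by
      refine intervalIntegral.integral_pos zero_lt_one hcont (fun x _ => sq_nonneg _) ?_
      by_contra! hall
      refine hp (eq_zero_of_infinite_isRoot p
        ((Set.Icc_infinite (zero_lt_one (α := ℝ))).mono fun x hx => ?_))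
      exact pow_eq_zero_iff two_ne_zero |>.1 (le_antisymm (hall x hx) (sq_nonneg _))
    simpa [N, p, eval_finsetSum] using h
  obtain ⟨δ, hδ, hbound⟩ : ∃ δ : ℝ, 0 < δ ∧ ∀ c : Fin (w + 1) → ℝ, δ * ‖c‖ ^ 2 ≤ N c := by
    obtain ⟨c₀, hc₀, hmin⟩ := (isCompact_sphere (0 : Fin (w + 1) → ℝ) 1).exists_isMinOn
      (NormedSpace.sphere_nonempty.2 zero_le_one) hN.continuousOn
    refine ⟨N c₀, hpos c₀ ?_, fun c => ?_⟩
    · rintro rfl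
      simp at hc₀
    · rcases eq_or_ne c 0 with rfl | hc
      · have := hsmul 0 0
        simp at this
        simp [this]
      · have hn : ‖c‖ ≠ 0 := norm_ne_zero_iff.2 hc
        have h1 : N c₀ ≤ N (‖c‖⁻¹ • c) := hmin (by simp [norm_smul, hn])
        rw [hsmul] at h1
        calc N c₀ * ‖c‖ ^ 2 ≤ (‖c‖⁻¹ ^ 2 * N c) * ‖c‖ ^ 2 := by gcongr
          _ = N c := by field_simp
  refine ⟨δ, hδ, fun p hp j => ?_⟩
  have hint : ∫ x in (0 : ℝ)..1, p.eval x ^ 2 = N fun i => p.coeff i := by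
    refine intervalIntegral.integral_congr fun x _ => ?_
    simp only [eval_eq_sum_range' (Nat.lt_succ_of_le hp) x, Finset.sum_range]
  rw [hint]
  refine le_trans ?_ (hbound _)
  rcases lt_or_ge w j with hj | hj
  · rw [coeff_eq_zero_of_natDegree_lt (hp.trans_lt hj)]
    simp only [ne_eq, OfNat.ofNat_ne_zero, not_false_eq_true, zero_pow, mul_zero]
    positivity
  · gcongr δ * ?_
    rw [← sq_abs]
    gcongr
    exact norm_le_pi_norm (fun i : Fin (w + 1) => p.coeff i) ⟨j, Nat.lt_succ_of_le hj⟩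

open Polynomial in
theorem sq_eval_le_of_sq_coeff_le {w : ℕ} {p : ℝ[X]} (hp : p.natDegree ≤ w) {B : ℝ}
    (hB : ∀ j, p.coeff j ^ 2 ≤ B) {x : ℝ} (hx : x ∈ Set.Icc (0 : ℝ) 1) :
    p.eval x ^ 2 ≤ (w + 1) ^ 2 * B := by
  have h : |p.eval x| ≤ (w + 1) * √B := by
    rw [eval_eq_sum_range' (Nat.lt_succ_of_le hp) x]
    refine (Finset.abs_sum_le_sum_abs _ _).trans ?_
    refine (Finset.sum_le_card_nsmul _ _ (√B) fun j _ => ?_).trans (by simp)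
    rw [abs_mul, abs_pow, abs_of_nonneg hx.1]
    calc |p.coeff j| * x ^ j ≤ |p.coeff j| * 1 := by
          gcongr
          exact pow_le_one₀ hx.1 hx.2
      _ ≤ √B := by
          rw [mul_one]
          exact Real.abs_le_sqrt (hB j)
  have hB0 : 0 ≤ B := (sq_nonneg _).trans (hB 0)
  calc p.eval x ^ 2 = |p.eval x| ^ 2 := (sq_abs _).symm
    _ ≤ ((w + 1) * √B) ^ 2 := by gcongr
    _ = (w + 1) ^ 2 * B := by rw [mul_pow, Real.sq_sqrt hB0]

open Polynomial in
theorem natDegree_comp_affine_le {w : ℕ} {p : ℝ[X]} (hp : p.natDegree ≤ w) (r s : ℝ) :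
    (p.comp (C r * X + C s)).natDegree ≤ w := by
  refine natDegree_comp_le.trans ((Nat.mul_le_mul hp (natDegree_linear_le)).trans ?_)
  simp

theorem exists_affine_eq {a b x : ℝ} (hab : a < b) (hx : x ∈ Set.Icc a b) :
    ∃ y ∈ Set.Icc (0 : ℝ) 1, x = (b - a) * y + a := by
  have h : 0 < b - a := sub_pos.2 hab
  refine ⟨(x - a) / (b - a), ⟨div_nonneg (sub_nonneg.2 hx.1) h.le, ?_⟩, by field_simp; ring⟩
  rw [div_le_one h]
  linarith [hx.2]

theorem integral_affine (f : ℝ → ℝ) (a b : ℝ) :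
    (b - a) * ∫ y in (0 : ℝ)..1, f ((b - a) * y + a) = ∫ x in a..b, f x := by
  simp

open Polynomial in
/-- Inverse inequality between the maximum and the `L²` norm of polynomials. -/
theorem exists_sq_eval_le_integral_sq (w : ℕ) :
    ∃ K : ℝ, 0 < K ∧ ∀ p : ℝ[X], p.natDegree ≤ w → ∀ a b : ℝ, a < b → ∀ x ∈ Set.Icc a b,
      (b - a) * p.eval x ^ 2 ≤ K * ∫ y in a..b, p.eval y ^ 2 := by
  obtain ⟨δ, hδ, h⟩ := exists_sq_coeff_le_integral_sq w
  refine ⟨(w + 1) ^ 2 / δ, by positivity, fun p hp a b hab x hx => ?_⟩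
  obtain ⟨y, hy, rfl⟩ := exists_affine_eq hab hx
  have hq := natDegree_comp_affine_le hp (b - a) a
  have hcoeff : ∀ j, (p.comp (C (b - a) * X + C a)).coeff j ^ 2 ≤
      (∫ x in (0 : ℝ)..1, (p.comp (C (b - a) * X + C a)).eval x ^ 2) / δ := fun j => by
    rw [le_div_iff₀' hδ]
    exact h _ hq j
  have hy' := sq_eval_le_of_sq_coeff_le hq hcoeff hy
  simp only [eval_comp, eval_add, eval_mul, eval_C, eval_X] at hy'
  rw [← integral_affine]
  have := mul_le_mul_of_nonneg_left hy' (sub_pos.2 hab).le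
  calc _ ≤ _ := this
    _ = _ := by ring

open Polynomial in
/-- The maximum of a polynomial is bounded by its initial value and a weighted `L²` norm of its
derivative. -/
theorem exists_sq_eval_le_integral_sq_derivative (w : ℕ) :
    ∃ K : ℝ, 0 < K ∧ ∀ p : ℝ[X], p.natDegree ≤ w → ∀ a b : ℝ, a < b → ∀ x ∈ Set.Icc a b,
      p.eval x ^ 2 ≤
        K * (p.eval a ^ 2 + ∫ y in a..b, (y - a) * p.derivative.eval y ^ 2) := by
  obtain ⟨δ, hδ, h⟩ := exists_sq_coeff_le_integral_sq w
  refine ⟨(w + 1) ^ 2 * (1 + 1 / δ), by positivity, fun p hp a b hab x hx => ?_⟩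
  obtain ⟨y, hy, rfl⟩ := exists_affine_eq hab hx
  have hτ : 0 < b - a := sub_pos.2 hab
  set q := p.comp (C (b - a) * X + C a) with hqdef
  have hq : q.natDegree ≤ w := natDegree_comp_affine_le hp (b - a) a
  have hXq : (X * derivative q).natDegree ≤ w := by
    rw [natDegree_le_iff_coeff_eq_zero] at hq ⊢
    intro j hj
    cases j with
    | zero => simp
    | succ j => simp [coeff_X_mul, coeff_derivative, hq _ hj]
  have hint : ∫ x in (0 : ℝ)..1, (X * derivative q).eval x ^ 2 ≤
      ∫ y in a..b, (y - a) * p.derivative.eval y ^ 2 := by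
    rw [← integral_affine (fun y => (y - a) * p.derivative.eval y ^ 2),
      ← intervalIntegral.integral_const_mul]
    have hcont : Continuous fun y => (y - a) * p.derivative.eval y ^ 2 := by fun_prop
    refine intervalIntegral.integral_mono_on zero_le_one
      (Continuous.intervalIntegrable (by fun_prop) _ _)
      (Continuous.intervalIntegrable (by fun_prop) _ _) fun x hx => ?_
    simp only [hqdef, derivative_comp, derivative_add, derivative_mul, derivative_C, derivative_X,
      eval_mul, eval_X, eval_add, eval_C, eval_comp, eval_zero, eval_one]
    have : x ^ 2 ≤ x := by nlinarith [hx.1, hx.2]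
    nlinarith [mul_le_mul_of_nonneg_right this
      (sq_nonneg ((b - a) * eval ((b - a) * x + a) (derivative p)))]
  have hI : 0 ≤ ∫ y in a..b, (y - a) * p.derivative.eval y ^ 2 :=
    intervalIntegral.integral_nonneg hab.le fun y hy =>
      mul_nonneg (sub_nonneg.2 hy.1) (sq_nonneg _)
  have hcoeff : ∀ j, q.coeff j ^ 2 ≤
      (1 + 1 / δ) * (p.eval a ^ 2 + ∫ y in a..b, (y - a) * p.derivative.eval y ^ 2) := fun j => by
    cases j with
    | zero =>
      have : q.coeff 0 = p.eval a := by simp [coeff_zero_eq_eval_zero, hqdef, eval_comp]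
      rw [this]
      have h1 : 0 ≤ 1 / δ * p.eval a ^ 2 := by positivity
      have h2 : 0 ≤ 1 / δ * ∫ y in a..b, (y - a) * p.derivative.eval y ^ 2 := by positivity
      nlinarith
    | succ j =>
      have h1 := (h _ hXq (j + 1)).trans hint
      rw [coeff_X_mul, coeff_derivative, mul_pow, ← le_div_iff₀' hδ] at h1
      have h2 : (1 : ℝ) ≤ ((j : ℝ) + 1) ^ 2 := by
        have : (0 : ℝ) ≤ j := j.cast_nonneg
        nlinarith
      have h3 := le_mul_of_one_le_right (sq_nonneg (q.coeff (j + 1))) h2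
      have h4 : 0 ≤ 1 / δ * p.eval a ^ 2 := by positivity
      have h5 : (∫ y in a..b, (y - a) * p.derivative.eval y ^ 2) / δ =
        1 / δ * ∫ y in a..b, (y - a) * p.derivative.eval y ^ 2 := by ring
      nlinarith [sq_nonneg (p.eval a)]
  have := sq_eval_le_of_sq_coeff_le hq hcoeff hy
  simp only [hqdef, eval_comp, eval_add, eval_mul, eval_C, eval_X] at this
  rwa [mul_assoc]

open Polynomial in
/-- `p` solves one step, on the interval `[a, b]`, of the scalar dG(`w`) scheme for
`y' + lam y = 0` with incoming value `y`. -/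
def IsScalarStep (w : ℕ) (lam a b y : ℝ) (p : ℝ[X]) : Prop :=
  ∀ q : ℝ[X], q.natDegree ≤ w →
    (∫ x in a..b, (p.derivative.eval x * q.eval x + lam * (p.eval x * q.eval x)))
      + (p.eval a - y) * q.eval a = 0

open Polynomial in
theorem IsScalarStep.energy {w : ℕ} {lam a b y : ℝ} {p : ℝ[X]} (hp : p.natDegree ≤ w)
    (h : IsScalarStep w lam a b y p) :
    p.eval b ^ 2 + (p.eval a - y) ^ 2 + 2 * lam * (∫ x in a..b, p.eval x ^ 2) = y ^ 2 := by
  have h1 := h p hp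
  have h2 : ∫ x in a..b, p.derivative.eval x * p.eval x = (p.eval b ^ 2 - p.eval a ^ 2) / 2 := by
    rw [intervalIntegral.integral_eq_sub_of_hasDerivAt (f := fun x => p.eval x ^ 2 / 2)
      (fun x _ => ?_) (Continuous.intervalIntegrable (by fun_prop) _ _)]
    · ring
    · exact (((p.hasDerivAt x).pow 2).div_const 2).congr_deriv (by push_cast; ring)
  rw [intervalIntegral.integral_add (Continuous.intervalIntegrable (by fun_prop) _ _)
    (Continuous.intervalIntegrable (by fun_prop) _ _), h2,
    intervalIntegral.integral_const_mul] at h1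
  simp only [← sq] at h1
  linarith

open Polynomial in
theorem IsScalarStep.integral_sq_derivative_le {w : ℕ} {lam a b y : ℝ} {p : ℝ[X]}
    (hab : a < b) (hp : p.natDegree ≤ w) (h : IsScalarStep w lam a b y p) :
    ∫ x in a..b, (x - a) * p.derivative.eval x ^ 2 ≤
      lam ^ 2 * (b - a) * ∫ x in a..b, p.eval x ^ 2 := by
  have hq : ((X - C a) * derivative p).natDegree ≤ w := by
    rw [sub_mul]
    refine (natDegree_sub_le _ _).trans (max_le ?_ ?_)
    · rw [natDegree_le_iff_coeff_eq_zero] at hp ⊢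
      intro j hj
      cases j with
      | zero => simp
      | succ j => simp [coeff_X_mul, coeff_derivative, hp _ hj]
    · exact (natDegree_C_mul_le _ _).trans
        ((natDegree_derivative_le p).trans ((Nat.sub_le _ _).trans hp))
  have h1 := h _ hq
  simp only [eval_mul, eval_sub, eval_X, eval_C, sub_self, zero_mul, mul_zero, add_zero] at h1
  have h2 : 0 ≤ ∫ x in a..b, (2 * (p.derivative.eval x * ((x - a) * p.derivative.eval x)
      + lam * (p.eval x * ((x - a) * p.derivative.eval x)))
      + (lam ^ 2 * (b - a) * p.eval x ^ 2 - (x - a) * p.derivative.eval x ^ 2)) := by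
    refine intervalIntegral.integral_nonneg hab.le fun x hx => ?_
    have hxa : 0 ≤ x - a := sub_nonneg.2 hx.1
    have hxb : 0 ≤ b - x := sub_nonneg.2 hx.2
    have e1 := mul_nonneg hxa (sq_nonneg (p.derivative.eval x + lam * p.eval x))
    have e2 := mul_nonneg hxb (sq_nonneg (lam * p.eval x))
    nlinarith
  rw [intervalIntegral.integral_add (Continuous.intervalIntegrable (by fun_prop) _ _)
    (Continuous.intervalIntegrable (by fun_prop) _ _), intervalIntegral.integral_const_mul, h1,
    intervalIntegral.integral_sub (Continuous.intervalIntegrable (by fun_prop) _ _)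
    (Continuous.intervalIntegrable (by fun_prop) _ _), intervalIntegral.integral_const_mul] at h2
  linarith

open Polynomial in
theorem exists_one_add_mul_abs_eval_le (w : ℕ) :
    ∃ B : ℝ, 0 < B ∧ ∀ (lam a b y : ℝ) (p : ℝ[X]), 0 ≤ lam → a < b → p.natDegree ≤ w →
      IsScalarStep w lam a b y p → ∀ x ∈ Set.Icc a b,
        (1 + lam * (b - a)) * |p.eval x| ≤ B * |y| := by
  obtain ⟨K₁, hK₁, h₁⟩ := exists_sq_eval_le_integral_sq w
  obtain ⟨K₂, hK₂, h₂⟩ := exists_sq_eval_le_integral_sq_derivative w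
  refine ⟨√(18 * K₂ + 4 * K₁ ^ 2), by positivity, fun lam a b y p hlam hab hp h x hx => ?_⟩
  have hτ : 0 < b - a := sub_pos.2 hab
  have hE := h.energy hp
  have hW := h.integral_sq_derivative_le hab hp
  have hinv := h₁ p hp a b hab
  have hder := h₂ p hp a b hab x hx
  have hJ : 0 ≤ ∫ x in a..b, p.eval x ^ 2 :=
    intervalIntegral.integral_nonneg hab.le fun x _ => sq_nonneg _
  set J := ∫ x in a..b, p.eval x ^ 2
  set W := ∫ x in a..b, (x - a) * p.derivative.eval x ^ 2
  set z := lam * (b - a) with hz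
  have hz0 : 0 ≤ z := by positivity
  have hlJ : 0 ≤ lam * J := by positivity
  have key : (1 + z) ^ 2 * p.eval x ^ 2 ≤ (18 * K₂ + 4 * K₁ ^ 2) * y ^ 2 := by
    rcases le_total z 1 with hz1 | hz1
    · have ha : p.eval a ^ 2 ≤ 4 * y ^ 2 := by
        nlinarith [sq_nonneg (p.eval a - 2 * y), sq_nonneg (p.eval b)]
      have hW' : W ≤ y ^ 2 / 2 := by
        have e : lam ^ 2 * (b - a) * J = z * (lam * J) := by rw [hz]; ring
        have e2 : lam * J ≤ y ^ 2 / 2 := by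
          nlinarith [sq_nonneg (p.eval a - y), sq_nonneg (p.eval b)]
        nlinarith
      have hp2 : p.eval x ^ 2 ≤ K₂ * (9 / 2 * y ^ 2) := hder.trans (by gcongr; linarith)
      calc (1 + z) ^ 2 * p.eval x ^ 2 ≤ (1 + 1) ^ 2 * (K₂ * (9 / 2 * y ^ 2)) := by gcongr
        _ ≤ (18 * K₂ + 4 * K₁ ^ 2) * y ^ 2 := by nlinarith [mul_nonneg (sq_nonneg K₁) (sq_nonneg y)]
    · have e1 : lam * J ≤ y * p.eval a := by nlinarith [sq_nonneg (p.eval a), sq_nonneg (p.eval b)]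
      have e2 : (lam * J) ^ 2 ≤ y ^ 2 * p.eval a ^ 2 := by
        rw [← mul_pow]
        gcongr
      have e3 := hinv a (Set.left_mem_Icc.2 hab.le)
      have e4 : lam ^ 2 * (b - a) * J ≤ K₁ * y ^ 2 := by
        rcases hJ.eq_or_lt with hJ0 | hJ0
        · rw [← hJ0]
          simp only [mul_zero]
          positivity
        · refine le_of_mul_le_mul_right ?_ hJ0
          calc lam ^ 2 * (b - a) * J * J = (lam * J) ^ 2 * (b - a) := by ring
            _ ≤ (y ^ 2 * p.eval a ^ 2) * (b - a) := by gcongr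
            _ = y ^ 2 * ((b - a) * p.eval a ^ 2) := by ring
            _ ≤ y ^ 2 * (K₁ * J) := by gcongr
            _ = K₁ * y ^ 2 * J := by ring
      have e5 : z ^ 2 * p.eval x ^ 2 ≤ K₁ ^ 2 * y ^ 2 := by
        calc z ^ 2 * p.eval x ^ 2 = lam ^ 2 * (b - a) * ((b - a) * p.eval x ^ 2) := by
              rw [hz]; ring
          _ ≤ lam ^ 2 * (b - a) * (K₁ * J) :=
              mul_le_mul_of_nonneg_left (hinv x hx) (by positivity)
          _ = K₁ * (lam ^ 2 * (b - a) * J) := by ring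
          _ ≤ K₁ * (K₁ * y ^ 2) := by gcongr
          _ = K₁ ^ 2 * y ^ 2 := by ring
      calc (1 + z) ^ 2 * p.eval x ^ 2 ≤ (z + z) ^ 2 * p.eval x ^ 2 := by gcongr
        _ = 4 * (z ^ 2 * p.eval x ^ 2) := by ring
        _ ≤ 4 * (K₁ ^ 2 * y ^ 2) := by gcongr
        _ ≤ (18 * K₂ + 4 * K₁ ^ 2) * y ^ 2 := by nlinarith [mul_nonneg hK₂.le (sq_nonneg y)]
  have := Real.sqrt_le_sqrt key
  rwa [← mul_pow, Real.sqrt_sq_eq_abs, abs_mul, abs_of_nonneg (by positivity),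
    Real.sqrt_mul (by positivity), Real.sqrt_sq_eq_abs] at this

open Polynomial in
theorem exists_one_add_mul_abs_eval_right_le (w : ℕ) :
    ∃ B : ℝ, 1 ≤ B ∧ ∀ (lam a b y : ℝ) (p : ℝ[X]), 0 ≤ lam → a < b → p.natDegree ≤ w →
      IsScalarStep w lam a b y p →
        (∀ x ∈ Set.Icc a b, (1 + lam * (b - a)) * |p.eval x| ≤ B * |y|) ∧
        (1 + lam * (b - a) / B) * |p.eval b| ≤ |y| := by
  obtain ⟨K, hK, hinv⟩ := exists_sq_eval_le_integral_sq w
  obtain ⟨B₀, hB₀, hdecay⟩ := exists_one_add_mul_abs_eval_le w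
  refine ⟨1 + 2 * K + 2 * B₀, by linarith, fun lam a b y p hlam hab hp h => ?_⟩
  have hstep := hdecay lam a b y p hlam hab hp h
  refine ⟨fun x hx => (hstep x hx).trans (by gcongr; linarith), ?_⟩
  have hb := hstep b (Set.right_mem_Icc.2 hab.le)
  have hE := h.energy hp
  have hpb := hinv p hp a b hab b (Set.right_mem_Icc.2 hab.le)
  have hτ : 0 < b - a := sub_pos.2 hab
  have hz0 : 0 ≤ lam * (b - a) := by positivity
  have hpb' : lam * (b - a) / K * p.eval b ^ 2 ≤ lam * ∫ x in a..b, p.eval x ^ 2 := by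
    rw [div_mul_eq_mul_div, div_le_iff₀ hK]
    calc _ = lam * ((b - a) * p.eval b ^ 2) := by ring
      _ ≤ lam * (K * ∫ x in a..b, p.eval x ^ 2) := by gcongr
      _ = _ := by ring
  set z := lam * (b - a)
  set B := 1 + 2 * K + 2 * B₀ with hB
  have hB0 : 0 < B := by positivity
  rcases le_total z (2 * B₀) with hz | hz
  · refine abs_le_of_sq_le_sq' ?_ (abs_nonneg y) |>.2
    rw [mul_pow, sq_abs, sq_abs]
    have hcoef : (1 + z / B) ^ 2 ≤ 1 + 2 * (z / K) := by
      have e1 : z / B ≤ z / K / 2 := by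
        rw [div_div]
        gcongr
        linarith
      have e2 : z / B ≤ 1 := by
        rw [div_le_one hB0]
        linarith
      have e3 : 0 ≤ z / B := by positivity
      nlinarith
    calc (1 + z / B) ^ 2 * p.eval b ^ 2 ≤ (1 + 2 * (z / K)) * p.eval b ^ 2 := by gcongr
      _ = p.eval b ^ 2 + 2 * (z / K * p.eval b ^ 2) := by ring
      _ ≤ y ^ 2 := by nlinarith [sq_nonneg (p.eval a - y)]
  · have hcoef : (1 + z / B) * B₀ ≤ 1 + z := by
      have : z / B * B₀ ≤ z / 2 := by
        rw [div_mul_eq_mul_div, div_le_div_iff₀ hB0 two_pos]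
        nlinarith
      linarith
    refine le_of_mul_le_mul_right ?_ hB₀
    calc (1 + z / B) * |p.eval b| * B₀ = (1 + z / B) * B₀ * |p.eval b| := by ring
      _ ≤ (1 + z) * |p.eval b| := by gcongr
      _ ≤ B₀ * |y| := hb
      _ = |y| * B₀ := mul_comm _ _

open Polynomial in
/-- Smoothing estimate for the scalar dG(`w`) scheme, uniform in `lam`. -/
theorem exists_scalar_smoothing (w : ℕ) :
    ∃ B : ℝ, 0 < B ∧ ∀ (lam : ℝ), 0 ≤ lam → ∀ (M : ℕ) (t : ℕ → ℝ), t 0 = 0 →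
      (∀ m, m < M → t m < t (m + 1)) → ∀ (y₀ : ℝ) (p : ℕ → ℝ[X]),
      (∀ m, 1 ≤ m → m ≤ M → (p m).natDegree ≤ w ∧ IsScalarStep w lam (t (m - 1)) (t m)
        (if m = 1 then y₀ else (p (m - 1)).eval (t (m - 1))) (p m)) →
      ∀ m, 1 ≤ m → m ≤ M → ∀ x ∈ Set.Icc (t (m - 1)) (t m),
        lam * |(p m).eval x| ≤ B / t m * |y₀| := by
  obtain ⟨B, hB, hstep⟩ := exists_one_add_mul_abs_eval_right_le w
  have hB0 : 0 < B := by linarith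
  refine ⟨B ^ 2, by positivity, fun lam hlam M t ht0 ht y₀ p hp => ?_⟩
  have htnn : ∀ m, m ≤ M → 0 ≤ t m := by
    intro m
    induction m with
    | zero => intro _; exact ht0.ge
    | succ m ih => intro hm; exact (ih (by omega)).trans (ht m hm).le
  have hprod : ∀ m, m < M → (1 + lam * t m / B) *
      |if m + 1 = 1 then y₀ else (p m).eval (t m)| ≤ |y₀| := by
    intro m
    induction m with
    | zero => intro _; simp [ht0]
    | succ m ih =>
      intro hm
      have hlt := ht m (by omega)
      obtain ⟨hd, hs⟩ := hp (m + 1) (by omega) hm.le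
      have h1 := (hstep _ _ _ _ _ hlam hlt hd hs).2
      have h2 := ih (by omega)
      have htm := htnn m (by omega)
      simp only [Nat.add_sub_cancel] at h1
      rw [if_neg (by omega)]
      have hτ : 0 < t (m + 1) - t m := sub_pos.2 hlt
      have hle : 1 + lam * t (m + 1) / B ≤
          (1 + lam * t m / B) * (1 + lam * (t (m + 1) - t m) / B) := by
        have e : lam * t (m + 1) / B = lam * t m / B + lam * (t (m + 1) - t m) / B := by ring
        have e1 : 0 ≤ lam * t m / B * (lam * (t (m + 1) - t m) / B) := by positivity
        nlinarith
      calc _ ≤ (1 + lam * t m / B) * (1 + lam * (t (m + 1) - t m) / B) *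
            |(p (m + 1)).eval (t (m + 1))| := by gcongr
        _ = (1 + lam * t m / B) * ((1 + lam * (t (m + 1) - t m) / B) *
            |(p (m + 1)).eval (t (m + 1))|) := by ring
        _ ≤ _ := (mul_le_mul_of_nonneg_left h1 (by positivity)).trans h2
  intro m hm1 hmM x hx
  obtain ⟨m, rfl⟩ : ∃ k, m = k + 1 := ⟨m - 1, by omega⟩
  simp only [Nat.add_sub_cancel] at hx
  have hlt := ht m hmM
  obtain ⟨hd, hs⟩ := hp (m + 1) hm1 hmM
  have h1 := (hstep _ _ _ _ _ hlam hlt hd hs).1 x hx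
  have h2 := hprod m hmM
  simp only [Nat.add_sub_cancel] at h1
  have htm := htnn m (by omega)
  have hτ : 0 < t (m + 1) - t m := sub_pos.2 hlt
  have htm1 : 0 < t (m + 1) := by linarith
  have hle : lam * t (m + 1) / B ≤
      (1 + lam * (t (m + 1) - t m)) * (1 + lam * t m / B) := by
    have e : lam * t (m + 1) / B = lam * t m / B + lam * (t (m + 1) - t m) / B := by ring
    have e0 : 0 ≤ lam * (t (m + 1) - t m) := by positivity
    have e1 : lam * (t (m + 1) - t m) / B ≤ lam * (t (m + 1) - t m) := div_le_self e0 hB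
    have e2 : 0 ≤ lam * t m / B := by positivity
    nlinarith [mul_nonneg e0 e2]
  have h3 : lam * t (m + 1) / B * |(p (m + 1)).eval x| ≤ B * |y₀| := by
    calc _ ≤ (1 + lam * (t (m + 1) - t m)) * (1 + lam * t m / B) * |(p (m + 1)).eval x| := by
          gcongr
      _ = (1 + lam * t m / B) *
          ((1 + lam * (t (m + 1) - t m)) * |(p (m + 1)).eval x|) := by ring
      _ ≤ _ := mul_le_mul_of_nonneg_left h1 (by positivity)
      _ = B * ((1 + lam * t m / B) * |if m + 1 = 1 then y₀ else (p m).eval (t m)|) := by ring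
      _ ≤ B * |y₀| := by gcongr
  rw [div_mul_eq_mul_div, le_div_iff₀ htm1]
  calc _ = B * (lam * t (m + 1) / B * |(p (m + 1)).eval x|) := by field_simp
    _ ≤ B * (B * |y₀|) := by gcongr
    _ = B ^ 2 * |y₀| := by ring

/-- `u` is a `Y`-valued polynomial of degree at most `w`. -/
def IsVectorPoly {Y : Type*} [AddCommGroup Y] [Module ℝ Y] (w : ℕ) (u : ℝ → Y) : Prop :=
  ∃ c : Fin (w + 1) → Y, ∀ s : ℝ, u s = ∑ j : Fin (w + 1), s ^ (j : ℕ) • c j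

namespace IsVectorPoly

theorem zero {Y : Type*} [AddCommGroup Y] [Module ℝ Y] (w : ℕ) :
    IsVectorPoly w (fun _ : ℝ => (0 : Y)) :=
  ⟨0, fun s => by simp⟩

theorem add {Y : Type*} [AddCommGroup Y] [Module ℝ Y] {w : ℕ} {u v : ℝ → Y}
    (hu : IsVectorPoly w u) (hv : IsVectorPoly w v) : IsVectorPoly w (fun s => u s + v s) := by
  obtain ⟨c, hc⟩ := hu
  obtain ⟨d, hd⟩ := hv
  exact ⟨c + d, fun s => by simp [hc, hd, Finset.sum_add_distrib]⟩

theorem map {Y Z : Type*} [AddCommGroup Y] [Module ℝ Y] [AddCommGroup Z] [Module ℝ Z] {w : ℕ}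
    {u : ℝ → Y} (hu : IsVectorPoly w u) (l : Y →ₗ[ℝ] Z) : IsVectorPoly w (fun s => l (u s)) := by
  obtain ⟨c, hc⟩ := hu
  exact ⟨fun j => l (c j), fun s => by simp [hc]⟩

open Polynomial in
theorem eval_smul {Y : Type*} [AddCommGroup Y] [Module ℝ Y] {w : ℕ} {q : ℝ[X]}
    (hq : q.natDegree ≤ w) (v : Y) : IsVectorPoly w (fun s => q.eval s • v) := by
  refine ⟨fun j => q.coeff j • v, fun s => ?_⟩
  simp only
  rw [eval_eq_sum_range' (Nat.lt_succ_of_le hq) s, Finset.sum_range, Finset.sum_smul]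
  simp only [smul_smul, mul_comm]

open Polynomial in
theorem exists_eval_eq {w : ℕ} {u : ℝ → ℝ} (hu : IsVectorPoly w u) :
    ∃ p : ℝ[X], p.natDegree ≤ w ∧ ∀ s, u s = p.eval s := by
  obtain ⟨c, hc⟩ := hu
  refine ⟨∑ j : Fin (w + 1), C (c j) * X ^ (j : ℕ), natDegree_sum_le_of_forall_le _ _ fun j _ =>
    (natDegree_C_mul_X_pow_le _ _).trans (Nat.le_of_lt_succ j.2), fun s => ?_⟩
  simp only [hc, eval_finsetSum, eval_mul, eval_C, eval_pow, eval_X, smul_eq_mul, mul_comm]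

theorem differentiable {Y : Type*} [NormedAddCommGroup Y] [NormedSpace ℝ Y] {w : ℕ} {u : ℝ → Y}
    (hu : IsVectorPoly w u) : Differentiable ℝ u := by
  obtain ⟨c, hc⟩ := hu
  rw [funext hc]
  fun_prop

theorem hasDerivAt_inner {Y : Type*} [NormedAddCommGroup Y] [InnerProductSpace ℝ Y] {w : ℕ}
    {u : ℝ → Y} (hu : IsVectorPoly w u) (v : Y) (s : ℝ) :
    HasDerivAt (fun s => ⟪u s, v⟫) ⟪deriv u s, v⟫ s := by
  simpa using (hu.differentiable s).hasDerivAt.inner ℝ (hasDerivAt_const s v)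

open Polynomial in
theorem exists_eval_eq_inner {Y : Type*} [NormedAddCommGroup Y] [InnerProductSpace ℝ Y] {w : ℕ}
    {u : ℝ → Y} (hu : IsVectorPoly w u) (v : Y) :
    ∃ p : ℝ[X], p.natDegree ≤ w ∧ (∀ s, ⟪u s, v⟫ = p.eval s) ∧
      ∀ s, ⟪deriv u s, v⟫ = p.derivative.eval s := by
  obtain ⟨p, hp, h⟩ := (hu.map (innerₗ Y v)).exists_eval_eq
  have h' : ∀ s, ⟪u s, v⟫ = p.eval s := fun s => (real_inner_comm _ _).trans (h s)
  refine ⟨p, hp, h', fun s => (hu.hasDerivAt_inner v s).unique ?_⟩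
  rw [funext h']
  exact p.hasDerivAt s

end IsVectorPoly

/-- Inverse inequality between the maximum and the `L²` norm of vector-valued polynomials. -/
theorem exists_sq_norm_le_integral_sq_norm (w : ℕ) :
    ∃ K : ℝ, 0 < K ∧ ∀ (Y : Type) [NormedAddCommGroup Y] [InnerProductSpace ℝ Y] (u : ℝ → Y),
      IsVectorPoly w u → ∀ a b : ℝ, a < b → ∀ x ∈ Set.Icc a b,
        (b - a) * ‖u x‖ ^ 2 ≤ K * ∫ y in a..b, ‖u y‖ ^ 2 := by
  obtain ⟨K, hK, h⟩ := exists_sq_eval_le_integral_sq w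
  refine ⟨K, hK, fun Y _ _ u hu a b hab x hx => ?_⟩
  obtain ⟨p, hp, hpu, -⟩ := hu.exists_eval_eq_inner (u x)
  have hcont := hu.differentiable.continuous
  have h1 := h p hp a b hab x hx
  simp only [← hpu, real_inner_self_eq_norm_sq] at h1
  have h2 : ∫ y in a..b, ⟪u y, u x⟫ ^ 2 ≤ ‖u x‖ ^ 2 * ∫ y in a..b, ‖u y‖ ^ 2 := by
    rw [← intervalIntegral.integral_const_mul]
    refine intervalIntegral.integral_mono_on hab.le
      (Continuous.intervalIntegrable (by fun_prop) _ _)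
      (Continuous.intervalIntegrable (by fun_prop) _ _) fun y _ => ?_
    rw [← mul_pow, mul_comm, ← sq_abs]
    gcongr
    exact abs_real_inner_le_norm _ _
  rcases eq_or_ne (u x) 0 with h0 | h0
  · rw [h0]
    simp only [norm_zero, ne_eq, OfNat.ofNat_ne_zero, not_false_eq_true, zero_pow, mul_zero]
    exact mul_nonneg hK.le (intervalIntegral.integral_nonneg hab.le fun _ _ => by positivity)
  · have hpos : 0 < ‖u x‖ ^ 2 := by positivity
    refine le_of_mul_le_mul_right ?_ hpos
    calc _ = (b - a) * (‖u x‖ ^ 2) ^ 2 := by ring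
      _ ≤ K * (‖u x‖ ^ 2 * ∫ y in a..b, ‖u y‖ ^ 2) := h1.trans (by gcongr)
      _ = _ := by ring

/-- `(u, p)` solves one step, on the interval `[s, t]`, of the homogeneous velocity–pressure
scheme with incoming velocity `y`. -/
def IsStokesStep {H Mp : Type} [NormedAddCommGroup H] [InnerProductSpace ℝ H]
    [NormedAddCommGroup Mp] [InnerProductSpace ℝ Mp] {X : Submodule ℝ H}
    (a : X →ₗ[ℝ] X →ₗ[ℝ] ℝ) (G : Mp →ₗ[ℝ] H) (w : ℕ) (s t : ℝ) (y : H)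
    (u : ℝ → X) (p : ℝ → Mp) : Prop :=
  ∀ (φ : ℝ → X) (ψ : ℝ → Mp), IsVectorPoly w φ → IsVectorPoly w ψ →
    (∫ σ in s..t, (⟪((deriv u σ : X) : H), (φ σ : H)⟫ + a (u σ) (φ σ)
        + ⟪(φ σ : H), G (p σ)⟫ - ⟪(u σ : H), G (ψ σ)⟫))
      + ⟪(u s : H) - y, (φ s : H)⟫ = 0

theorem FullSchemeH.isStokesStep {H Mp : Type} [NormedAddCommGroup H] [InnerProductSpace ℝ H]
    [NormedAddCommGroup Mp] [InnerProductSpace ℝ Mp] {X : Submodule ℝ H}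
    {a : X →ₗ[ℝ] X →ₗ[ℝ] ℝ} {G : Mp →ₗ[ℝ] H} {w M : ℕ} {t : ℕ → ℝ} {u₀ : H}
    {U : ℕ → ℝ → X} {P : ℕ → ℝ → Mp}
    (h : FullSchemeH a G w M t (fun _ => (0 : H)) u₀ U P) {m : ℕ} (hm : 1 ≤ m) (hmM : m ≤ M) :
    IsStokesStep a G w (t (m - 1)) (t m)
      (if m = 1 then u₀ else (U (m - 1) (t (m - 1)) : H)) (U m) (P m) := by
  intro φ ψ hφ hψ
  have key := h (fun k s => if k = m then φ s else 0) (fun k s => if k = m then ψ s else 0)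
    (fun k _ _ => by
      change IsVectorPoly w _
      by_cases hk : k = m
      · simpa [hk] using hφ
      · simpa [hk] using IsVectorPoly.zero w)
    (fun k _ _ => by
      change IsVectorPoly w _
      by_cases hk : k = m
      · simpa [hk] using hψ
      · simpa [hk] using IsVectorPoly.zero w)
  rw [Finset.sum_eq_single_of_mem m (Finset.mem_Icc.2 ⟨hm, hmM⟩)
    (fun k _ hk => by simp [hk])] at key
  simp only [if_true, inner_zero_left, intervalIntegral.integral_zero, Finset.sum_const_zero,
    zero_add] at key
  by_cases h1 : m = 1
  · subst h1
    rw [Finset.sum_eq_zero (fun k hk => by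
      have : k ≠ 1 := by
        have := (Finset.mem_Icc.1 hk).1
        omega
      simp [this])] at key
    simp only [if_true, inner_sub_left, Nat.sub_self] at key ⊢
    linarith
  · rw [Finset.sum_eq_single_of_mem m (Finset.mem_Icc.2 ⟨by omega, hmM⟩)
      (fun k _ hk => by simp [hk])] at key
    simp only [if_true, if_neg (Ne.symm h1), Submodule.coe_zero, inner_zero_right,
      add_zero] at key
    simpa [h1] using key

/-- The discretely divergence-free subspace. -/
def discreteDivFree {H Mp : Type} [NormedAddCommGroup H] [InnerProductSpace ℝ H]
    [NormedAddCommGroup Mp] [InnerProductSpace ℝ Mp] (X : Submodule ℝ H)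
    (G : Mp →ₗ[ℝ] H) : Submodule ℝ X where
  carrier := {v | ∀ q, ⟪(v : H), G q⟫ = 0}
  add_mem' := fun hu hv q => by simp [inner_add_left, hu q, hv q]
  zero_mem' := fun q => by simp
  smul_mem' := fun r v hv q => by simp [inner_smul_left, hv q]

section Step

variable {H Mp : Type} [NormedAddCommGroup H] [InnerProductSpace ℝ H]
  [NormedAddCommGroup Mp] [InnerProductSpace ℝ Mp] {X : Submodule ℝ H}
  {a : X →ₗ[ℝ] X →ₗ[ℝ] ℝ} {G : Mp →ₗ[ℝ] H} {w : ℕ} {s t : ℝ} {y : H}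
  {u : ℝ → X} {p : ℝ → Mp}

theorem IsStokesStep.mem_discreteDivFree (h : IsStokesStep a G w s t y u p) (hst : s < t)
    (hu : IsVectorPoly w u) (σ : ℝ) : u σ ∈ discreteDivFree X G := by
  intro q
  obtain ⟨r, hr, hru⟩ := (hu.map (innerₗ H (G q) ∘ₗ X.subtype)).exists_eval_eq
  replace hru : ∀ σ, ⟪(u σ : H), G q⟫ = r.eval σ := fun σ => (real_inner_comm _ _).trans (hru σ)
  obtain ⟨K, hK, hinv⟩ := exists_sq_eval_le_integral_sq w
  have h1 := h _ _ (IsVectorPoly.zero w) (IsVectorPoly.eval_smul hr q)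
  simp only [Submodule.coe_zero, inner_zero_right, inner_zero_left, map_zero, map_smul,
    inner_smul_right, hru, add_zero, zero_sub, intervalIntegral.integral_neg,
    neg_eq_zero, ← sq] at h1
  have h2 : r = 0 := by
    refine r.eq_zero_of_infinite_isRoot ((Set.Icc_infinite hst).mono fun x hx => ?_)
    have h3 := hinv r hr s t hst x hx
    rw [h1, mul_zero] at h3
    have h4 := nonpos_of_mul_nonpos_right h3 (sub_pos.2 hst)
    exact pow_eq_zero_iff two_ne_zero |>.1 (le_antisymm h4 (sq_nonneg _))
  rw [hru, h2, Polynomial.eval_zero]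

open Polynomial in
theorem IsStokesStep.isScalarStep (h : IsStokesStep a G w s t y u p)
    (hu : ∀ σ, u σ ∈ discreteDivFree X G) {v : X} (hv : v ∈ discreteDivFree X G) {lam : ℝ}
    (hlam : ∀ z ∈ discreteDivFree X G, a z v = lam * ⟪z, v⟫) {r : ℝ[X]}
    (hr : ∀ σ, ⟪u σ, v⟫ = r.eval σ) (hr' : ∀ σ, ⟪deriv u σ, v⟫ = r.derivative.eval σ) :
    IsScalarStep w lam s t ⟪y, (v : H)⟫ r := by
  intro q hq
  have h1 := h _ _ (IsVectorPoly.eval_smul hq v) (IsVectorPoly.zero w)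
  simp only [Submodule.coe_smul, inner_smul_left, inner_smul_right, map_zero, map_smul,
    inner_zero_right, sub_zero, hv _, mul_zero, add_zero, inner_sub_left, ← Submodule.coe_inner,
    hr, hr', hlam _ (hu _), smul_eq_mul] at h1
  rw [← h1]
  congr 1
  · exact intervalIntegral.integral_congr fun x _ => by ring
  · ring

end Step

/-- A symmetric positive definite form on a finite-dimensional inner product space has an
orthonormal eigenbasis on every subspace. -/
theorem exists_eigenbasis_of_form {X : Type*} [NormedAddCommGroup X] [InnerProductSpace ℝ X]
    [FiniteDimensional ℝ X] (a : X →ₗ[ℝ] X →ₗ[ℝ] ℝ) (L : X →ₗ[ℝ] X)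
    (hsymm : ∀ u v, a u v = a v u) (hpos : ∀ v, v ≠ 0 → 0 < a v v)
    (hL : ∀ z v, ⟪L z, v⟫ = a z v) (V : Submodule ℝ X) :
    ∃ (n : ℕ) (e : OrthonormalBasis (Fin n) ℝ V) (lam : Fin n → ℝ),
      (∀ i, 0 ≤ lam i) ∧ ∀ i, ∀ z ∈ V, a z (e i) = lam i * ⟪z, (e i : X)⟫ := by
  let A : V →ₗ[ℝ] V := V.orthogonalProjectionOnto.toLinearMap ∘ₗ L ∘ₗ V.subtype
  have hAa : ∀ u v : V, ⟪A u, v⟫ = a u v := fun u v => by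
    simp only [A, LinearMap.comp_apply, ContinuousLinearMap.coe_coe, Submodule.subtype_apply,
      Submodule.inner_orthogonalProjectionOnto_eq_of_mem_right, hL]
  have hA : A.IsSymmetric := fun u v => by
    rw [hAa, ← real_inner_comm, hAa, hsymm]
  let e := hA.eigenvectorBasis rfl
  have heig : ∀ i, ∀ z ∈ V, a z (e i) = hA.eigenvalues rfl i * ⟪z, (e i : X)⟫ := by
    intro i z hz
    have h1 := hAa (e i) ⟨z, hz⟩
    simp only [e, hA.apply_eigenvectorBasis] at h1
    rw [hsymm, ← h1, inner_smul_left, real_inner_comm]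
    rfl
  refine ⟨_, e, hA.eigenvalues rfl, fun i => ?_, heig⟩
  have hne : (e i : X) ≠ 0 := fun h0 =>
    e.orthonormal.ne_zero i (Subtype.ext h0)
  have h1 := hpos _ hne
  rw [heig i _ (e i).2] at h1
  exact (pos_of_mul_pos_left h1 real_inner_self_nonneg).le

open Polynomial in
/-- Smoothing estimate for the discrete Stokes operator applied to the velocity. -/
theorem exists_norm_starProjection_smoothing (w : ℕ) :
    ∃ B : ℝ, 0 < B ∧ ∀ (H Mp : Type) [NormedAddCommGroup H] [InnerProductSpace ℝ H]
      [NormedAddCommGroup Mp] [InnerProductSpace ℝ Mp]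
      (X : Submodule ℝ H) [FiniteDimensional ℝ X] (a : X →ₗ[ℝ] X →ₗ[ℝ] ℝ) (G : Mp →ₗ[ℝ] H)
      (L : X →ₗ[ℝ] X), (∀ u v, a u v = a v u) → (∀ v, v ≠ 0 → 0 < a v v) →
      (∀ z v, ⟪L z, v⟫ = a z v) → ∀ (M : ℕ) (t : ℕ → ℝ), t 0 = 0 →
      (∀ m, m < M → t m < t (m + 1)) → ∀ (u₀ : H) (U : ℕ → ℝ → X) (P : ℕ → ℝ → Mp),
      PPoly w M U → FullSchemeH a G w M t (fun _ => (0 : H)) u₀ U P →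
      ∀ m, 1 ≤ m → m ≤ M → ∀ σ ∈ Set.Icc (t (m - 1)) (t m),
        ‖(discreteDivFree X G).starProjection (L (U m σ))‖ ≤ B / t m * ‖u₀‖ := by
  obtain ⟨B, hB, hsm⟩ := exists_scalar_smoothing w
  refine ⟨B, hB, ?_⟩
  intro H Mp _ _ _ _ X _ a G L hsymm hpos hL M t ht0 ht u₀ U P hU hscheme m hm hmM σ hσ
  set V := discreteDivFree X G with hV
  obtain ⟨n, e, lam, hlam, heig⟩ := exists_eigenbasis_of_form a L hsymm hpos hL V
  have htlt : ∀ m, 1 ≤ m → m ≤ M → t (m - 1) < t m := fun m hm hmM => by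
    have := ht (m - 1) (by omega)
    rwa [Nat.sub_add_cancel hm] at this
  have htm : 0 < t m := by
    have h0 : ∀ k, k ≤ M → 0 ≤ t k := by
      intro k
      induction k with
      | zero => intro _; exact ht0.ge
      | succ k ih => intro hk; exact (ih (by omega)).trans (ht k hk).le
    exact (h0 (m - 1) (by omega)).trans_lt (htlt m hm hmM)
  have hUV : ∀ k, 1 ≤ k → k ≤ M → ∀ σ, U k σ ∈ V := fun k hk hkM =>
    (hscheme.isStokesStep hk hkM).mem_discreteDivFree (htlt k hk hkM) (hU k hk hkM)
  have hcomp : ∀ i, |⟪(e i : X), L (U m σ)⟫| ≤ B / t m * |⟪((e i : X) : H), u₀⟫| := by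
    intro i
    have hr : ∀ k, ∃ r : ℝ[X], 1 ≤ k → k ≤ M → r.natDegree ≤ w ∧
        (∀ s, ⟪U k s, (e i : X)⟫ = r.eval s) ∧
        ∀ s, ⟪deriv (U k) s, (e i : X)⟫ = r.derivative.eval s := fun k => by
      by_cases hk : 1 ≤ k ∧ k ≤ M
      · obtain ⟨r, hr⟩ := IsVectorPoly.exists_eval_eq_inner (hU k hk.1 hk.2) (e i : X)
        exact ⟨r, fun _ _ => hr⟩
      · exact ⟨0, fun h1 h2 => absurd ⟨h1, h2⟩ hk⟩
    choose r hr using hr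
    have h1 := hsm (lam i) (hlam i) M t ht0 ht ⟪u₀, ((e i : X) : H)⟫ r ?_ m hm hmM σ hσ
    · rw [real_inner_comm, hL, heig i _ (hUV m hm hmM σ), abs_mul, abs_of_nonneg (hlam i),
        (hr m hm hmM).2.1, real_inner_comm]
      exact h1
    · intro k hk hkM
      refine ⟨(hr k hk hkM).1, ?_⟩
      have h2 := (hscheme.isStokesStep hk hkM).isScalarStep (hUV k hk hkM) (e i).2 (heig i)
        (hr k hk hkM).2.1 (hr k hk hkM).2.2
      convert h2 using 1
      split_ifs with hk1
      · rfl
      · rw [← (hr (k - 1) (by omega) (by omega)).2.1]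
        rfl
  have horth : Orthonormal ℝ fun i => ((e i : X) : H) :=
    (e.orthonormal.comp_linearIsometry V.subtypeₗᵢ).comp_linearIsometry X.subtypeₗᵢ
  refine abs_le_of_sq_le_sq' ?_ (by positivity) |>.2
  rw [Submodule.starProjection_apply, ← Submodule.coe_norm, ← e.sum_sq_norm_inner_right, mul_pow]
  calc ∑ i, ‖⟪e i, V.orthogonalProjectionOnto (L (U m σ))⟫‖ ^ 2
      ≤ ∑ i, (B / t m) ^ 2 * ‖⟪((e i : X) : H), u₀⟫‖ ^ 2 := by
        refine Finset.sum_le_sum fun i _ => ?_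
        rw [Submodule.inner_orthogonalProjectionOnto_eq_of_mem_left, ← mul_pow]
        gcongr
        exact hcomp i
    _ = (B / t m) ^ 2 * ∑ i, ‖⟪((e i : X) : H), u₀⟫‖ ^ 2 := by rw [Finset.mul_sum]
    _ ≤ (B / t m) ^ 2 * ‖u₀‖ ^ 2 := by
        gcongr
        exact horth.sum_inner_products_le u₀

/-- The part of `L u + Π_X G p` orthogonal to the discretely divergence-free subspace only
feels the part of the incoming velocity that is not discretely divergence-free. -/
theorem exists_norm_orthogonal_residual_le (w : ℕ) :
    ∃ K : ℝ, 0 < K ∧ ∀ (H Mp : Type) [NormedAddCommGroup H] [InnerProductSpace ℝ H]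
      [NormedAddCommGroup Mp] [InnerProductSpace ℝ Mp]
      (X : Submodule ℝ H) [FiniteDimensional ℝ X] (a : X →ₗ[ℝ] X →ₗ[ℝ] ℝ) (G : Mp →ₗ[ℝ] H)
      (L : X →ₗ[ℝ] X), (∀ z v, ⟪L z, v⟫ = a z v) →
      ∀ (s t : ℝ) (y y' : H) (u : ℝ → X) (p : ℝ → Mp), s < t → IsVectorPoly w u →
      IsVectorPoly w p → IsStokesStep a G w s t y u p →
      (∀ v ∈ (discreteDivFree X G)ᗮ, ⟪y, (v : H)⟫ = ⟪y', (v : H)⟫) → ∀ σ ∈ Set.Icc s t,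
        ‖(discreteDivFree X G)ᗮ.starProjection
          (L (u σ) + X.orthogonalProjectionOnto (G (p σ)))‖ ≤ K / (t - s) * ‖y'‖ := by
  obtain ⟨K, hK, hinv⟩ := exists_sq_norm_le_integral_sq_norm w
  refine ⟨K, hK, ?_⟩
  intro H Mp _ _ _ _ X _ a G L hL s t y y' u p hst hu hp h hy σ hσ
  set V := discreteDivFree X G with hV
  have huV : ∀ σ, u σ ∈ V := h.mem_discreteDivFree hst hu
  have hτ : 0 < t - s := sub_pos.2 hst
  set D : ℝ → X := fun σ =>
    Vᗮ.starProjection (L (u σ) + X.orthogonalProjectionOnto (G (p σ))) with hD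
  have hDpoly : IsVectorPoly w D :=
    ((hu.map L).add ((hp.map G).map X.orthogonalProjectionOnto.toLinearMap)).map
      Vᗮ.starProjection.toLinearMap
  have hDmem : ∀ σ, D σ ∈ Vᗮ := fun σ => Submodule.starProjection_apply_mem _ _
  have hderiv : ∀ σ, ⟪deriv u σ, D σ⟫ = 0 := fun σ => by
    refine (hu.hasDerivAt_inner (D σ) σ).unique ?_
    have : (fun s => ⟪u s, D σ⟫) = fun _ => 0 :=
      funext fun s => Submodule.inner_right_of_mem_orthogonal (huV s) (hDmem σ)
    rw [this]
    exact hasDerivAt_const _ _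
  have hintegrand : ∀ σ, a (u σ) (D σ) + ⟪(D σ : H), G (p σ)⟫ = ‖D σ‖ ^ 2 := fun σ => by
    have h1 : ⟪(D σ : H), G (p σ)⟫ = ⟪D σ, X.orthogonalProjectionOnto (G (p σ))⟫ :=
      (Submodule.inner_orthogonalProjectionOnto_eq_of_mem_left _ _).symm
    have h2 := Submodule.starProjection_inner_eq_zero (K := Vᗮ)
      (L (u σ) + X.orthogonalProjectionOnto (G (p σ))) (D σ) (hDmem σ)
    rw [inner_sub_left, sub_eq_zero, inner_add_left, hL] at h2
    rw [h1, real_inner_comm, h2, real_inner_self_eq_norm_sq]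
  have h1 := h D _ hDpoly (IsVectorPoly.zero w)
  simp only [← Submodule.coe_inner, hderiv, zero_add, hintegrand, map_zero, inner_zero_right,
    sub_zero, inner_sub_left, Submodule.inner_right_of_mem_orthogonal (huV s) (hDmem s),
    hy _ (hDmem s), zero_sub] at h1
  have hJ0 : 0 ≤ ∫ σ in s..t, ‖D σ‖ ^ 2 :=
    intervalIntegral.integral_nonneg hst.le fun _ _ => by positivity
  have hs := hinv X D hDpoly s t hst s (Set.left_mem_Icc.2 hst.le)
  have hσ' := hinv X D hDpoly s t hst σ hσ
  set J := ∫ σ in s..t, ‖D σ‖ ^ 2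
  have hJ : J ≤ ‖y'‖ * ‖D s‖ := by
    have := real_inner_le_norm y' (D s : H)
    rw [Submodule.coe_norm]
    linarith
  have hJ2 : (t - s) * J ≤ K * ‖y'‖ ^ 2 := by
    rcases hJ0.eq_or_lt with h0 | h0
    · rw [← h0, mul_zero]
      positivity
    · refine le_of_mul_le_mul_right ?_ h0
      calc (t - s) * J * J = (t - s) * J ^ 2 := by ring
        _ ≤ (t - s) * (‖y'‖ * ‖D s‖) ^ 2 := by gcongr
        _ = ‖y'‖ ^ 2 * ((t - s) * ‖D s‖ ^ 2) := by ring
        _ ≤ ‖y'‖ ^ 2 * (K * J) := by gcongr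
        _ = K * ‖y'‖ ^ 2 * J := by ring
  refine abs_le_of_sq_le_sq' ?_ (by positivity) |>.2
  rw [div_mul_eq_mul_div, div_pow, le_div_iff₀ (by positivity)]
  calc ‖D σ‖ ^ 2 * (t - s) ^ 2 = (t - s) * ((t - s) * ‖D σ‖ ^ 2) := by ring
    _ ≤ (t - s) * (K * J) := by gcongr
    _ = K * ((t - s) * J) := by ring
    _ ≤ K * (K * ‖y'‖ ^ 2) := by gcongr
    _ = (K * ‖y'‖) ^ 2 := by ring

/-- **Smoothing estimate for the discrete pressure gradient (Corollary 8.3), abstract form.**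
There is a constant `C` depending only on `w`, the mesh constants `κ, c, β`, the gradient
inf-sup constant `C_G` and the constant `c_Δ` such that for the solution `(u_τ, p_τ)` of the
full velocity–pressure scheme with `f = 0` and initial value `u₀ ∈ H`, for every `m = 1, …, M`,
`sup_{t ∈ I_m} ‖G p_τ(t)‖_H ≤ (C / t_m) ‖u₀‖_H`. -/
theorem stmt14 :
    ∀ (w : ℕ) (κ c β CG cΔ : ℝ), 1 ≤ κ → 0 < c → 0 < β → 0 < CG → 0 < cΔ →
    ∃ C : ℝ, 0 < C ∧
      ∀ (H : Type) [NormedAddCommGroup H] [InnerProductSpace ℝ H],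
      ∀ (Mp : Type) [NormedAddCommGroup Mp] [InnerProductSpace ℝ Mp] [FiniteDimensional ℝ Mp],
      ∀ (X : Submodule ℝ H) [FiniteDimensional ℝ X],
      ∀ (a : X →ₗ[ℝ] X →ₗ[ℝ] ℝ) (G : Mp →ₗ[ℝ] H) (L : X →ₗ[ℝ] X),
        (∀ u v : X, a u v = a v u) →
        (∀ v : X, v ≠ 0 → 0 < a v v) →
        (∀ q : Mp, CG * ‖G q‖ ≤ ⨆ v : {v : X // v ≠ 0}, ⟪G q, ((v : X) : H)⟫ / ‖((v : X) : H)‖) →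
        (∀ z v : X, ⟪(L z : H), (v : H)⟫ = a z v) →
        (∀ v av : X, (∀ q : Mp, ⟪(v : H), G q⟫ = 0) → (∀ q : Mp, ⟪(av : H), G q⟫ = 0) →
          (∀ z : X, (∀ q : Mp, ⟪(z : H), G q⟫ = 0) → ⟪(av : H), (z : H)⟫ = a v z) →
          ‖(L v : H)‖ ≤ cΔ * ‖(av : H)‖) →
      ∀ (T : ℝ) (M : ℕ) (t : ℕ → ℝ) (τ τmin : ℝ),
        0 < T → 1 ≤ M → t 0 = 0 → t M = T →
        (∀ m, m < M → t m < t (m + 1)) →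
        (∀ m, 1 ≤ m → m ≤ M → t m - t (m - 1) ≤ τ) →
        (∃ m, 1 ≤ m ∧ m ≤ M ∧ τ = t m - t (m - 1)) →
        (∀ m, 1 ≤ m → m ≤ M → τmin ≤ t m - t (m - 1)) →
        (∃ m, 1 ≤ m ∧ m ≤ M ∧ τmin = t m - t (m - 1)) →
        τ ≤ T / 4 →
        (∀ m, 1 ≤ m → m + 1 ≤ M →
          κ⁻¹ ≤ (t m - t (m - 1)) / (t (m + 1) - t m) ∧
            (t m - t (m - 1)) / (t (m + 1) - t m) ≤ κ) →
        c * τ ^ β ≤ τmin →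
      ∀ (u₀ : H),
      ∀ (U : ℕ → ℝ → X) (P : ℕ → ℝ → Mp), PPoly w M U → PPoly w M P →
        FullSchemeH a G w M t (fun _ => (0 : H)) u₀ U P →
      ∀ m, 1 ≤ m → m ≤ M →
        (⨆ σ : Set.Ioc (t (m - 1)) (t m), ‖G (P m (σ : ℝ))‖) ≤ C / t m * ‖u₀‖ := by
  intro w κ c β CG cΔ _ _ _ hCG hcΔ
  obtain ⟨B, hB, hsm⟩ := exists_norm_starProjection_smoothing w
  obtain ⟨K, hK, hres⟩ := exists_norm_orthogonal_residual_le w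
  refine ⟨(K + (1 + cΔ) * B) / CG, by positivity, ?_⟩
  intro H _ _ Mp _ _ _ X _ a G L hsymm hpos hinfsup hL hΔ T M t τ τmin _ _ ht0 _ ht _ _ _ _ _ _ _
    u₀ U P hU hP hscheme m hm hmM
  set V := discreteDivFree X G with hV
  have htlt : t (m - 1) < t m := by
    have := ht (m - 1) (by omega)
    rwa [Nat.sub_add_cancel hm] at this
  have htm : 0 < t m := by
    have h0 : ∀ k, k ≤ M → 0 ≤ t k := by
      intro k
      induction k with
      | zero => intro _; exact ht0.ge
      | succ k ih => intro hk; exact (ih (by omega)).trans (ht k hk).le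
    exact (h0 (m - 1) (by omega)).trans_lt htlt
  have hstep := hscheme.isStokesStep hm hmM
  refine Real.iSup_le (fun ⟨σ, hσ⟩ => ?_) (by positivity)
  replace hσ : σ ∈ Set.Icc (t (m - 1)) (t m) := Set.Ioc_subset_Icc_self hσ
  have hA := hsm H Mp X a G L hsymm hpos hL M t ht0 ht u₀ U P hU hscheme m hm hmM σ hσ
  have hD : ‖Vᗮ.starProjection (L (U m σ) + X.orthogonalProjectionOnto (G (P m σ)))‖ ≤
      K / t m * ‖u₀‖ := by
    by_cases h1 : m = 1
    · subst h1
      have := hres H Mp X a G L hL _ _ _ u₀ _ _ htlt (hU 1 hm hmM) (hP 1 hm hmM) hstep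
        (fun v _ => by simp) σ hσ
      simpa [ht0] using this
    · have := hres H Mp X a G L hL _ _ _ 0 _ _ htlt (hU m hm hmM) (hP m hm hmM) hstep
        (fun v hv => by
          rw [if_neg h1, inner_zero_left]
          have hprev : U (m - 1) (t (m - 1)) ∈ V := by
            have hlt := ht (m - 1 - 1) (by omega)
            rw [Nat.sub_add_cancel (by omega)] at hlt
            exact (hscheme.isStokesStep (m := m - 1) (by omega) (by omega)).mem_discreteDivFree
              hlt (hU (m - 1) (by omega) (by omega)) _
          exact Submodule.inner_right_of_mem_orthogonal (K := V) hprev hv) σ hσ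
      rw [norm_zero, mul_zero] at this
      exact this.trans (by positivity)
  have hLu : ‖L (U m σ)‖ ≤ cΔ * ‖V.starProjection (L (U m σ))‖ := by
    refine hΔ _ _ (hstep.mem_discreteDivFree htlt (hU m hm hmM) σ)
      (Submodule.starProjection_apply_mem V _) fun z hz => ?_
    have h2 := Submodule.starProjection_inner_eq_zero (K := V) (L (U m σ)) z hz
    rw [inner_sub_left, sub_eq_zero] at h2
    exact h2.symm.trans (hL _ _)
  have hproj : V.starProjection (X.orthogonalProjectionOnto (G (P m σ))) = 0 := by
    rw [Submodule.starProjection_apply_eq_zero_iff, Submodule.mem_orthogonal]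
    intro v hv
    exact (Submodule.inner_orthogonalProjectionOnto_eq_of_mem_left v _).trans (hv _)
  have hbound : ‖X.orthogonalProjectionOnto (G (P m σ))‖ ≤
      (K + (1 + cΔ) * B) / t m * ‖u₀‖ := by
    have hdecomp : X.orthogonalProjectionOnto (G (P m σ)) =
        Vᗮ.starProjection (L (U m σ) + X.orthogonalProjectionOnto (G (P m σ)))
          + V.starProjection (L (U m σ)) - L (U m σ) := by
      have h3 := V.starProjection_add_starProjection_orthogonal
        (L (U m σ) + X.orthogonalProjectionOnto (G (P m σ)))
      rw [map_add V.starProjection, hproj, add_zero, add_comm] at h3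
      rw [h3, add_sub_cancel_left]
    calc ‖X.orthogonalProjectionOnto (G (P m σ))‖
        ≤ K / t m * ‖u₀‖ + B / t m * ‖u₀‖ + cΔ * (B / t m * ‖u₀‖) := by
          rw [hdecomp]
          exact (norm_sub_le _ _).trans (add_le_add ((norm_add_le _ _).trans (add_le_add hD hA))
            (hLu.trans (by gcongr)))
      _ = (K + (1 + cΔ) * B) / t m * ‖u₀‖ := by ring
  have hG : CG * ‖G (P m σ)‖ ≤ ‖X.orthogonalProjectionOnto (G (P m σ))‖ := by
    refine (hinfsup _).trans (Real.iSup_le (fun ⟨v, hv⟩ => ?_) (norm_nonneg _))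
    have hvpos : 0 < ‖(v : H)‖ := norm_pos_iff.2 fun h0 => hv (Subtype.ext h0)
    rw [div_le_iff₀ hvpos, ← Submodule.inner_orthogonalProjectionOnto_eq_of_mem_right]
    exact real_inner_le_norm _ _
  calc ‖G (P m σ)‖ ≤ ((K + (1 + cΔ) * B) / t m * ‖u₀‖) / CG := by
        rw [le_div_iff₀' hCG]
        exact hG.trans hbound
    _ = _ := by ring
end
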